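/- arXiv:2408.05872 — 6 statements merged into one kernel-verified Lean document; each statement's English description precedes it below -/
import Mathlib

section
/- Let q be an odd prime and let l ∈ ℕ with 1 ≤ l ≤ q. If a_1, a_2, …, a_l are non-zero integers such that the polynomial (x^q − a_1)(x^q − a_2)⋯(x^q − a_l) has a root modulo every positive integer, then there exists an index j_0 ∈ {1, …, l} such that a_{j_0} is a perfect q-th power. -/
section

open NumberField Filter Topology UniqueFactorizationMonoid

section IdealSums

variable {R : Type*} [CommRing R] [IsDedekindDomain R]

/-- A sum of a multiplicative function over ideals supported on `T` is at most the Euler product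
over `T`. -/
theorem sum_ideal_le_prod_inv_one_sub (g : Ideal R →* ℝ) (hg : ∀ I, 0 ≤ g I)
    (T A : Finset (Ideal R)) (hT : ∀ P ∈ T, g P < 1) (hA0 : ∀ I ∈ A, I ≠ ⊥)
    (hA : ∀ I ∈ A, ∀ P ∈ normalizedFactors I, P ∈ T) :
    ∑ I ∈ A, g I ≤ ∏ P ∈ T, (1 - g P)⁻¹ := by
  classical
  obtain ⟨N, hN⟩ : ∃ N : ℕ, ∀ I ∈ A, (normalizedFactors I).card < N :=
    ⟨A.sup (fun I ↦ (normalizedFactors I).card) + 1, fun I hI ↦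
      Nat.lt_succ_of_le (Finset.le_sup (f := fun I ↦ (normalizedFactors I).card) hI)⟩
  have hprod (I : Ideal R) (hI : I ∈ A) :
      ∏ P ∈ T, P ^ (normalizedFactors I).count P = I := by
    rw [← Finset.prod_multiset_count_of_subset _ _
      fun P hP ↦ hA I hI P (Multiset.mem_toFinset.mp hP)]
    exact Ideal.prod_normalizedFactors_eq_self (hA0 I hI)
  let v : Ideal R → (P : Ideal R) → P ∈ T → ℕ := fun I P _ ↦ (normalizedFactors I).count P
  have hterm (I : Ideal R) (hI : I ∈ A) : g I = ∏ x ∈ T.attach, g x.1 ^ v I x.1 x.2 := by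
    calc g I = g (∏ P ∈ T, P ^ (normalizedFactors I).count P) := by rw [hprod I hI]
      _ = ∏ P ∈ T, g P ^ (normalizedFactors I).count P := by simp only [map_prod, map_pow]
      _ = _ := (Finset.prod_attach T fun P ↦ g P ^ (normalizedFactors I).count P).symm
  have hinj : Set.InjOn v A := by
    intro I hI J hJ hIJ
    rw [← hprod I hI, ← hprod J hJ]
    refine Finset.prod_congr rfl fun P hP ↦ ?_
    have : v I P hP = v J P hP := by rw [hIJ]
    exact congrArg (P ^ ·) this
  calc ∑ I ∈ A, g I
      = ∑ w ∈ A.image v, ∏ x ∈ T.attach, g x.1 ^ w x.1 x.2 := by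
        rw [Finset.sum_image hinj]
        exact Finset.sum_congr rfl hterm
    _ ≤ ∑ w ∈ T.pi fun _ ↦ Finset.range N, ∏ x ∈ T.attach, g x.1 ^ w x.1 x.2 := by
        refine Finset.sum_le_sum_of_subset_of_nonneg ?_ fun w _ _ ↦
          Finset.prod_nonneg fun x _ ↦ pow_nonneg (hg _) _
        intro w hw
        obtain ⟨I, hI, rfl⟩ := Finset.mem_image.mp hw
        exact Finset.mem_pi.mpr fun P _ ↦ Finset.mem_range.mpr
          ((Multiset.count_le_card _ _).trans_lt (hN I hI))
    _ = ∏ P ∈ T, ∑ k ∈ Finset.range N, g P ^ k :=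
      (Finset.prod_sum T (fun _ ↦ Finset.range N) fun P k ↦ g P ^ k).symm
    _ ≤ ∏ P ∈ T, (1 - g P)⁻¹ := by
        refine Finset.prod_le_prod (fun P _ ↦ Finset.sum_nonneg fun k _ ↦ pow_nonneg (hg _) _)
          fun P hP ↦ ?_
        rw [← tsum_geometric_of_lt_one (hg P) (hT P hP)]
        exact (summable_geometric_of_lt_one (hg P) (hT P hP)).sum_le_tsum _
          fun k _ ↦ pow_nonneg (hg _) _

/-- A finite product `∏ (1 + g P)` over primes is a sum of `g` over a finite set of ideals. -/
theorem exists_prod_one_add_eq_sum_ideal (g : Ideal R →* ℝ) (T : Finset (Ideal R))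
    (hT : ∀ P ∈ T, Prime P) :
    ∃ A : Finset (Ideal R), ∏ P ∈ T, (1 + g P) = ∑ I ∈ A, g I := by
  classical
  have hfac (S : Finset (Ideal R)) (hS : S ∈ T.powerset) :
      normalizedFactors (∏ P ∈ S, P) = S.val := by
    have := normalizedFactors_prod_of_prime (m := S.val)
      fun P hP ↦ hT P (Finset.mem_powerset.mp hS hP)
    simpa [Finset.prod_val] using this
  refine ⟨T.powerset.image fun S ↦ ∏ P ∈ S, P, ?_⟩
  rw [Finset.prod_one_add, Finset.sum_image]
  · simp
  · intro S hS S' hS' h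
    exact Finset.val_injective (by rw [← hfac S hS, ← hfac S' hS']; exact congrArg _ h)

end IdealSums

section Zeta

variable (K : Type*) [Field K] [NumberField K]

/-- The Dedekind zeta function at a real argument. -/
noncomputable def realZeta (s : ℝ) : ℝ :=
  ∑' n : ℕ, (Nat.card {I : Ideal (𝓞 K) // I.absNorm = n} : ℝ) * (n : ℝ) ^ (-s)

/-- The function `I ↦ N(I) ^ (-s)` as a monoid homomorphism. -/
noncomputable def normRpow (s : ℝ) : Ideal (𝓞 K) →* ℝ where
  toFun I := (I.absNorm : ℝ) ^ (-s)
  map_one' := by simp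
  map_mul' I J := by simp [Real.mul_rpow]

variable {K}

theorem normRpow_apply (s : ℝ) (I : Ideal (𝓞 K)) : normRpow K s I = (I.absNorm : ℝ) ^ (-s) := rfl

theorem normRpow_nonneg (s : ℝ) (I : Ideal (𝓞 K)) : 0 ≤ normRpow K s I :=
  Real.rpow_nonneg (Nat.cast_nonneg _) _

theorem dedekindZeta_ofReal {s : ℝ} (hs : 1 < s) : dedekindZeta K s = realZeta K s := by
  rw [dedekindZeta, LSeries, realZeta, Complex.ofReal_tsum]
  refine tsum_congr fun n ↦ ?_
  rcases eq_or_ne n 0 with rfl | hn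
  · simp [Real.zero_rpow (by linarith : -s ≠ 0)]
  · rw [LSeries.term_of_ne_zero hn, Real.rpow_neg (Nat.cast_nonneg n)]
    push_cast
    rw [Complex.ofReal_cpow (Nat.cast_nonneg n)]
    simp [div_eq_mul_inv]

variable (K) in
theorem tendsto_sub_one_mul_realZeta :
    Tendsto (fun s : ℝ ↦ (s - 1) * realZeta K s) (𝓝[>] 1) (𝓝 (dedekindZeta_residue K)) := by
  have h := (Complex.continuous_re.tendsto _).comp (tendsto_sub_one_mul_dedekindZeta_nhdsGT K)
  refine h.congr' ?_
  filter_upwards [self_mem_nhdsWithin] with s hs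
  simp only [Function.comp_apply, dedekindZeta_ofReal (K := K) hs]
  norm_cast

variable (K) in
theorem eventually_summable_realZeta : ∀ᶠ s : ℝ in 𝓝[>] 1, Summable fun n : ℕ ↦
    (Nat.card {I : Ideal (𝓞 K) // I.absNorm = n} : ℝ) * (n : ℝ) ^ (-s) := by
  filter_upwards [(tendsto_sub_one_mul_realZeta K).eventually_ne (dedekindZeta_residue_ne_zero K)]
    with s hs
  by_contra h
  exact hs (by rw [realZeta, tsum_eq_zero_of_not_summable h, mul_zero])

theorem sum_normRpow_le_realZeta {s : ℝ} (hs : Summable fun n : ℕ ↦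
    (Nat.card {I : Ideal (𝓞 K) // I.absNorm = n} : ℝ) * (n : ℝ) ^ (-s))
    (A : Finset (Ideal (𝓞 K))) : ∑ I ∈ A, normRpow K s I ≤ realZeta K s := by
  classical
  calc ∑ I ∈ A, normRpow K s I
      = ∑ n ∈ A.image Ideal.absNorm,
          ((A.filter fun I ↦ I.absNorm = n).card : ℝ) * (n : ℝ) ^ (-s) := by
        simp only [normRpow_apply]
        rw [Finset.sum_comp (fun n : ℕ ↦ (n : ℝ) ^ (-s)) (Ideal.absNorm (S := 𝓞 K))]
        simp
    _ ≤ ∑ n ∈ A.image Ideal.absNorm,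
          (Nat.card {I : Ideal (𝓞 K) // I.absNorm = n} : ℝ) * (n : ℝ) ^ (-s) := by
        refine Finset.sum_le_sum fun n _ ↦ mul_le_mul_of_nonneg_right ?_ (by positivity)
        have hfin := Ideal.finite_setOfPred_absNorm_eq (S := 𝓞 K) n
        have := Set.ncard_le_ncard (s := (A.filter fun I ↦ I.absNorm = n : Finset _))
          (t := {I : Ideal (𝓞 K) | I.absNorm = n}) (by intro I; simp) hfin
        rw [Set.ncard_coe_finset] at this
        exact_mod_cast this
    _ ≤ _ := hs.sum_le_tsum _ fun n _ ↦ by positivity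

theorem realZeta_le {s B : ℝ} (hs : 1 < s)
    (h : ∀ A : Finset (Ideal (𝓞 K)), (∀ I ∈ A, I ≠ ⊥) → ∑ I ∈ A, normRpow K s I ≤ B) :
    realZeta K s ≤ B := by
  classical
  refine Real.tsum_le_of_sum_range_le (fun n ↦ by positivity) fun N ↦ ?_
  have hfin (n : ℕ) := Ideal.finite_setOfPred_absNorm_eq (S := 𝓞 K) n
  refine le_trans (le_of_eq ?_)
    (h (((Finset.range N).erase 0).biUnion fun n ↦ (hfin n).toFinset) fun I hI ↦ ?_)
  · rw [Finset.sum_biUnion]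
    · rw [← Finset.sum_erase (a := 0) _ (by simp [Real.zero_rpow (by linarith : -s ≠ 0)])]
      refine Finset.sum_congr rfl fun n _ ↦ ?_
      rw [Finset.sum_congr rfl (g := fun _ ↦ (n : ℝ) ^ (-s))
        fun I hI ↦ by rw [normRpow_apply, show I.absNorm = n by simpa using hI]]
      rw [Finset.sum_const, nsmul_eq_mul]
      congr 2
      rw [← Set.ncard_eq_toFinset_card _ (hfin n)]
      rfl
    · intro m _ n _ hmn
      refine Finset.disjoint_left.mpr fun I hI hI' ↦ hmn ?_
      simp only [Set.Finite.mem_toFinset, Set.mem_ofPred_eq] at hI hI'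
      exact hI.symm.trans hI'
  · rintro rfl
    simp at hI

end Zeta

section Comparison

theorem inv_one_sub_le_exp {x : ℝ} (hx0 : 0 ≤ x) (hx : x ≤ 1 / 2) :
    (1 - x)⁻¹ ≤ Real.exp (2 * x) := by
  refine le_trans ?_ (Real.add_one_le_exp _)
  rw [inv_le_iff_one_le_mul₀ (by linarith)]
  nlinarith

variable {K : Type*} [Field K] [NumberField K]

theorem exists_prime_absNorm_eq_pow {P : Ideal (𝓞 K)} (hP : Prime P) :
    ∃ p f : ℕ, p.Prime ∧ f ≠ 0 ∧ (p : 𝓞 K) ∈ P ∧ P.absNorm = p ^ f := by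
  have hP0 : P ≠ ⊥ := hP.ne_zero
  have : P.IsPrime := Ideal.isPrime_of_prime hP
  have : P.IsMaximal := this.isMaximal hP0
  let := Ideal.Quotient.field P
  let := Fintype.ofFinite (𝓞 K ⧸ P)
  obtain ⟨p, _⟩ := CharP.exists (𝓞 K ⧸ P)
  obtain ⟨f, hp, hf⟩ := FiniteField.card (𝓞 K ⧸ P) p
  refine ⟨p, f, hp, f.ne_zero, ?_, ?_⟩
  · rw [← Ideal.Quotient.eq_zero_iff_mem]
    simp
  · rw [Ideal.absNorm_apply, Submodule.cardQuot_apply, Nat.card_eq_fintype_card, hf]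

variable (K) in
/-- At most `[K : ℚ]` primes lie over each rational prime, so the sum of `p ^ (-2)` over primes
of `K`, with `p` the residue characteristic, is bounded. -/
theorem exists_sum_minFac_absNorm_le : ∃ C : ℝ, ∀ T : Finset (Ideal (𝓞 K)), (∀ P ∈ T, Prime P) →
    ∑ P ∈ T, ((P.absNorm.minFac : ℝ) ^ 2)⁻¹ ≤ C := by
  classical
  refine ⟨∑' n : ℕ, (Module.finrank ℚ K : ℝ) * ((n : ℝ) ^ 2)⁻¹, fun T hT ↦ ?_⟩
  have hsum : Summable fun n : ℕ ↦ (Module.finrank ℚ K : ℝ) * ((n : ℝ) ^ 2)⁻¹ :=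
    (Real.summable_nat_pow_inv.mpr one_lt_two).mul_left _
  let V : Finset ℕ := T.image fun P ↦ P.absNorm.minFac
  calc ∑ P ∈ T, ((P.absNorm.minFac : ℝ) ^ 2)⁻¹
      = ∑ p ∈ V,
          ((T.filter fun P ↦ P.absNorm.minFac = p).card : ℝ) * ((p : ℝ) ^ 2)⁻¹ := by
        rw [Finset.sum_comp (fun p : ℕ ↦ ((p : ℝ) ^ 2)⁻¹)
          (fun P : Ideal (𝓞 K) ↦ P.absNorm.minFac)]
        simp [V]
    _ ≤ ∑ p ∈ V,
          (Module.finrank ℚ K : ℝ) * ((p : ℝ) ^ 2)⁻¹ := by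
        refine Finset.sum_le_sum fun p hp ↦ mul_le_mul_of_nonneg_right ?_ (by positivity)
        set S := T.filter fun P ↦ P.absNorm.minFac = p
        have hS (P : Ideal (𝓞 K)) (hP : P ∈ S) :
            p.Prime ∧ P ∣ Ideal.span {(p : 𝓞 K)} ∧ p ≤ P.absNorm := by
          obtain ⟨hPT, hPp⟩ := Finset.mem_filter.mp hP
          obtain ⟨r, f, hr, hf, hrP, hN⟩ := exists_prime_absNorm_eq_pow (hT P hPT)
          rw [hN, hr.pow_minFac hf] at hPp
          subst hPp
          refine ⟨hr, ?_, ?_⟩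
          · rwa [Ideal.dvd_span_singleton]
          · rw [hN]
            exact Nat.le_self_pow hf r
        have hp' : p.Prime := by
          obtain ⟨P, hP, rfl⟩ := Finset.mem_image.mp hp
          exact (hS P (Finset.mem_filter.mpr ⟨hP, rfl⟩)).1
        have hdvd : ∏ P ∈ S, P ∣ Ideal.span {(p : 𝓞 K)} :=
          Finset.prod_primes_dvd _ (fun P hP ↦ hT P (Finset.mem_filter.mp hP).1)
            fun P hP ↦ (hS P hP).2.1
        have hnorm : (Ideal.span {(p : 𝓞 K)}).absNorm = p ^ Module.finrank ℚ K := by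
          rw [Ideal.absNorm_span_natCast, RingOfIntegers.rank]
        have hle : p ^ S.card ≤ p ^ Module.finrank ℚ K := by
          calc p ^ S.card = ∏ P ∈ S, p := by simp
            _ ≤ ∏ P ∈ S, P.absNorm := Finset.prod_le_prod' fun P hP ↦ (hS P hP).2.2
            _ = (∏ P ∈ S, P).absNorm := (map_prod _ _ _).symm
            _ ≤ p ^ Module.finrank ℚ K :=
              Nat.le_of_dvd (pow_pos hp'.pos _) (hnorm ▸ Ideal.absNorm_dvd_absNorm_of_le
                (Ideal.dvd_iff_le.mp hdvd))
        exact_mod_cast (Nat.pow_le_pow_iff_right hp'.one_lt).mp hle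
    _ ≤ _ := hsum.sum_le_tsum _ fun n _ ↦ by positivity

/-- Up to a factor whose product over all primes converges, the Euler factor at `P` is `1 + N(P)⁻ˢ`
if `N(P)` is a prime not dividing `B`, and is trivial otherwise. -/
theorem inv_one_sub_normRpow_le {P : Ideal (𝓞 K)} (hP : Prime P) {B : ℕ} (hB : B ≠ 0) {s : ℝ}
    (hs : 1 < s) :
    (1 - normRpow K s P)⁻¹ ≤
      (if P.absNorm.Prime ∧ ¬ P.absNorm ∣ B then 1 + normRpow K s P else 1) *
        Real.exp (2 * B ^ 2 * ((P.absNorm.minFac : ℝ) ^ 2)⁻¹) := by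
  obtain ⟨p, f, hp, hf, -, hN⟩ := exists_prime_absNorm_eq_pow hP
  have hmin : P.absNorm.minFac = p := by rw [hN, hp.pow_minFac hf]
  have hB1 : (1 : ℝ) ≤ B := by exact_mod_cast Nat.one_le_iff_ne_zero.mpr hB
  have hp2 : (2 : ℝ) ≤ p := by exact_mod_cast hp.two_le
  have hNp : (p : ℝ) ≤ P.absNorm := by
    rw [hN]; exact_mod_cast Nat.le_self_pow hf p
  have hx0 := normRpow_nonneg s P
  have hxN : normRpow K s P ≤ (P.absNorm : ℝ)⁻¹ := by
    rw [normRpow_apply, ← Real.rpow_neg_one]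
    exact Real.rpow_le_rpow_of_exponent_le (by linarith) (by linarith)
  have hNinv : (P.absNorm : ℝ)⁻¹ ≤ (p : ℝ)⁻¹ := inv_anti₀ (by linarith) hNp
  have hpinv : (p : ℝ)⁻¹ ≤ 1 / 2 := by
    rw [one_div]; exact inv_anti₀ two_pos hp2
  have hinv0 : 0 < (p : ℝ)⁻¹ := by positivity
  rw [hmin, ← inv_pow]
  set x := normRpow K s P
  set y := (p : ℝ)⁻¹
  have hxy : x ≤ y := hxN.trans hNinv
  split_ifs with h
  · have h1 : (1 - x)⁻¹ = (1 + x) * (1 - x ^ 2)⁻¹ := by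
      have : 1 - x ≠ 0 := by linarith
      have : 1 - x ^ 2 ≠ 0 := by nlinarith
      field_simp
      ring
    rw [h1]
    refine mul_le_mul_of_nonneg_left ?_ (by linarith)
    refine (inv_one_sub_le_exp (sq_nonneg x) (by nlinarith)).trans (Real.exp_le_exp.mpr ?_)
    have hx2 : x ^ 2 ≤ y ^ 2 := pow_le_pow_left₀ hx0 hxy 2
    nlinarith [mul_nonneg (sub_nonneg.mpr (one_le_pow₀ hB1 (n := 2))) (sq_nonneg y)]
  · rw [one_mul]
    refine (inv_one_sub_le_exp hx0 (by linarith)).trans (Real.exp_le_exp.mpr ?_)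
    suffices x ≤ B ^ 2 * y ^ 2 by linarith
    by_cases hf1 : f = 1
    · subst hf1
      rw [pow_one] at hN
      have hpB : p ∣ B := by
        by_contra hpB
        exact h (hN ▸ ⟨hp, hpB⟩)
      have hpB' : (p : ℝ) ≤ B := by
        exact_mod_cast Nat.le_of_dvd (Nat.pos_of_ne_zero hB) hpB
      have : 1 ≤ B * y := by
        rw [← mul_inv_cancel₀ (show (p : ℝ) ≠ 0 by linarith)]
        exact mul_le_mul_of_nonneg_right hpB' hinv0.le
      nlinarith
    · have : (P.absNorm : ℝ)⁻¹ ≤ y ^ 2 := by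
        rw [hN, Nat.cast_pow, ← inv_pow]
        exact pow_le_pow_of_le_one hinv0.le (by linarith) (by lia)
      nlinarith [mul_nonneg (sub_nonneg.mpr (one_le_pow₀ hB1 (n := 2))) (sq_nonneg y)]

variable {L : Type*} [Field L] [NumberField L] [Algebra K L]

/-- If over every prime of `K` whose norm is a prime not dividing `B` there are `q` primes of `L` of
the same norm, then `ζ_K(s) ^ q = O(ζ_L(s))` as `s` tends to `1` from above. -/
theorem exists_realZeta_pow_le {B q : ℕ} (hB : B ≠ 0) (hq : q ≠ 0)
    (h : ∀ p : Ideal (𝓞 K), Prime p → p.absNorm.Prime → ¬ p.absNorm ∣ B →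
      ∃ F : Finset (Ideal (𝓞 L)), F.card = q ∧
        ∀ P ∈ F, Prime P ∧ Ideal.absNorm P = p.absNorm ∧ P.under (𝓞 K) = p) :
    ∃ E : ℝ, 0 ≤ E ∧ ∀ᶠ s : ℝ in 𝓝[>] 1, realZeta K s ^ q ≤ E * realZeta L s := by
  classical
  obtain ⟨C, hC⟩ := exists_sum_minFac_absNorm_le K
  have h' (p : Ideal (𝓞 K)) : ∃ F : Finset (Ideal (𝓞 L)),
      Prime p ∧ p.absNorm.Prime ∧ ¬ p.absNorm ∣ B → F.card = q ∧
        ∀ P ∈ F, Prime P ∧ Ideal.absNorm P = p.absNorm ∧ P.under (𝓞 K) = p := by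
    by_cases hp : Prime p ∧ p.absNorm.Prime ∧ ¬ p.absNorm ∣ B
    · obtain ⟨F, hF⟩ := h p hp.1 hp.2.1 hp.2.2
      exact ⟨F, fun _ ↦ hF⟩
    · exact ⟨∅, fun hp' ↦ absurd hp' hp⟩
  choose F hF using h'
  refine ⟨Real.exp (2 * B ^ 2 * C) ^ q, by positivity, ?_⟩
  filter_upwards [eventually_summable_realZeta L, self_mem_nhdsWithin] with s hsL hs
  have hs : 1 < s := hs
  have hL0 : 0 ≤ realZeta L s := tsum_nonneg fun n ↦ by positivity
  suffices hK : realZeta K s ≤ (Real.exp (2 * B ^ 2 * C) ^ q * realZeta L s) ^ (q⁻¹ : ℝ) by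
    have hK0 : 0 ≤ realZeta K s := tsum_nonneg fun n ↦ by positivity
    refine (pow_le_pow_left₀ hK0 hK q).trans_eq (Real.rpow_inv_natCast_pow (by positivity) hq)
  refine realZeta_le hs fun A hA ↦ ?_
  have hA0 : 0 ≤ ∑ I ∈ A, normRpow K s I := Finset.sum_nonneg fun I _ ↦ normRpow_nonneg s I
  rw [Real.le_rpow_inv_iff_of_pos hA0 (by positivity) (by positivity), Real.rpow_natCast]
  let T := A.biUnion fun I ↦ (normalizedFactors I).toFinset
  have hT (P : Ideal (𝓞 K)) (hP : P ∈ T) : Prime P := by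
    obtain ⟨I, hI, hPI⟩ := Finset.mem_biUnion.mp hP
    exact prime_of_normalized_factor P (Multiset.mem_toFinset.mp hPI)
  have hlt (P : Ideal (𝓞 K)) (hP : P ∈ T) : normRpow K s P < 1 := by
    obtain ⟨p, f, hp, hf, -, hN⟩ := exists_prime_absNorm_eq_pow (hT P hP)
    refine Real.rpow_lt_one_of_one_lt_of_neg ?_ (by linarith)
    rw [hN]
    exact_mod_cast Nat.one_lt_pow hf hp.one_lt
  let G := T.filter fun P ↦ P.absNorm.Prime ∧ ¬ P.absNorm ∣ B
  have hG (p : Ideal (𝓞 K)) (hp : p ∈ G) := hF p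
    ⟨hT p (Finset.mem_filter.mp hp).1, (Finset.mem_filter.mp hp).2⟩
  have hle : ∑ I ∈ A, normRpow K s I ≤
      (∏ P ∈ G, (1 + normRpow K s P)) * Real.exp (2 * B ^ 2 * C) := by
    refine (sum_ideal_le_prod_inv_one_sub (normRpow K s) (normRpow_nonneg s) T A hlt hA
      fun I hI P hP ↦ Finset.mem_biUnion.mpr ⟨I, hI, Multiset.mem_toFinset.mpr hP⟩).trans ?_
    refine (Finset.prod_le_prod (fun P hP ↦ inv_nonneg.mpr (by linarith [hlt P hP]))
      fun P hP ↦ inv_one_sub_normRpow_le (hT P hP) hB hs).trans ?_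
    rw [Finset.prod_mul_distrib, ← Finset.prod_filter, ← Real.exp_sum, ← Finset.mul_sum]
    refine mul_le_mul_of_nonneg_left (Real.exp_le_exp.mpr ?_)
      (Finset.prod_nonneg fun P _ ↦ by linarith [normRpow_nonneg s P])
    exact mul_le_mul_of_nonneg_left (hC T hT) (by positivity)
  have hsplit : (∏ P ∈ G, (1 + normRpow K s P)) ^ q ≤ realZeta L s := by
    have hdisj : (G : Set (Ideal (𝓞 K))).PairwiseDisjoint F := by
      intro p hp p' hp' hne
      refine Finset.disjoint_left.mpr fun P hP hP' ↦ hne ?_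
      rw [← ((hG p hp).2 P hP).2.2, ← ((hG p' hp').2 P hP').2.2]
    obtain ⟨A', hA'⟩ := exists_prod_one_add_eq_sum_ideal (normRpow L s) (G.biUnion F)
      fun P hP ↦ by
        obtain ⟨p, hp, hpP⟩ := Finset.mem_biUnion.mp hP
        exact ((hG p hp).2 P hpP).1
    refine le_trans (le_of_eq ?_) (sum_normRpow_le_realZeta hsL A')
    rw [← hA', Finset.prod_biUnion hdisj, ← Finset.prod_pow]
    refine Finset.prod_congr rfl fun p hp ↦ ?_
    rw [← (hG p hp).1, ← Finset.prod_const]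
    refine Finset.prod_congr rfl fun P hP ↦ ?_
    rw [normRpow_apply, normRpow_apply, ((hG p hp).2 P hP).2.1]
  calc (∑ I ∈ A, normRpow K s I) ^ q
      ≤ ((∏ P ∈ G, (1 + normRpow K s P)) * Real.exp (2 * B ^ 2 * C)) ^ q :=
        pow_le_pow_left₀ hA0 hle q
    _ ≤ Real.exp (2 * B ^ 2 * C) ^ q * realZeta L s := by
        rw [mul_pow, mul_comm]
        exact mul_le_mul_of_nonneg_left hsplit (by positivity)

/-- An extension of number fields `L / K` cannot have `q ≥ 2` primes of `L` of the same norm over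
all but finitely many primes of `K` of degree one. -/
theorem exists_prime_not_split {B q : ℕ} (hB : B ≠ 0) (hq : 2 ≤ q) :
    ∃ p : Ideal (𝓞 K), Prime p ∧ p.absNorm.Prime ∧ ¬ p.absNorm ∣ B ∧
      ∀ F : Finset (Ideal (𝓞 L)), F.card = q →
        ¬ ∀ P ∈ F, Prime P ∧ Ideal.absNorm P = p.absNorm ∧ P.under (𝓞 K) = p := by
  by_contra! h
  obtain ⟨E, hE0, hE⟩ := exists_realZeta_pow_le (K := K) (L := L) hB (by lia : q ≠ 0) h
  have hK := (tendsto_sub_one_mul_realZeta K).pow q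
  have hL := tendsto_sub_one_mul_realZeta L
  have h0 : Tendsto (fun s : ℝ ↦ (s - 1) ^ (q - 1)) (𝓝[>] 1) (𝓝 0) := by
    refine tendsto_nhdsWithin_of_tendsto_nhds ?_
    have : Continuous fun s : ℝ ↦ (s - 1) ^ (q - 1) := by fun_prop
    simpa [show q - 1 ≠ 0 by lia] using this.tendsto 1
  have hle := le_of_tendsto_of_tendsto hK ((h0.const_mul E).mul hL) (by
    filter_upwards [hE, self_mem_nhdsWithin] with s hs hs1
    have hs1 : 0 < s - 1 := sub_pos.mpr hs1
    calc ((s - 1) * realZeta K s) ^ q = (s - 1) ^ q * realZeta K s ^ q := mul_pow _ _ _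
      _ ≤ (s - 1) ^ q * (E * realZeta L s) := mul_le_mul_of_nonneg_left hs (by positivity)
      _ = E * (s - 1) ^ (q - 1) * ((s - 1) * realZeta L s) := by
        obtain ⟨k, rfl⟩ : ∃ k, q = k + 1 := ⟨q - 1, by lia⟩
        rw [Nat.add_sub_cancel, pow_succ]
        ring)
  have := pow_pos (dedekindZeta_residue_pos K) q
  simp only [mul_zero, zero_mul] at hle
  linarith

end Comparison

section Splitting

open scoped Pointwise

variable {K L : Type*} [Field K] [NumberField K] [Field L] [NumberField L] [Algebra K L]
  {G : Type*} [Group G] [MulSemiringAction G L] [IsGaloisGroup G K L]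

/-- If `r ∤ q * a` and `a` is a `q`-th power modulo `r`, then a Galois automorphism fixing the
`q`-th roots of unity but not `α = a ^ (1 / q)` fixes no prime above `r`. -/
theorem smul_prime_ne {q : ℕ} (hq : 0 < q) {ζ : 𝓞 L} (hζ : IsPrimitiveRoot ζ q) {g : G}
    (hgζ : g • ζ = ζ) {α : 𝓞 L} {a : ℤ} (hα : α ^ q = a) (hgα : g • α ≠ α) {r : ℕ} (hr : r.Prime)
    (hrq : ¬ r ∣ q) (hra : ¬ (r : ℤ) ∣ a) {x : ℤ} (hx : (r : ℤ) ∣ x ^ q - a)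
    {P : Ideal (𝓞 L)} [hP : P.IsPrime] (hrP : (r : 𝓞 L) ∈ P) : g • P ≠ P := by
  intro hgP
  have not_mem {n : ℤ} (hn : ¬ (r : ℤ) ∣ n) : (n : 𝓞 L) ∉ P := by
    intro hnP
    obtain ⟨u, v, huv⟩ :=
      (Nat.prime_iff_prime_int.mp hr).coprime_iff_not_dvd.mpr hn
    refine hP.ne_top (P.eq_top_iff_one.mpr ?_)
    have : ((u * r + v * n : ℤ) : 𝓞 L) ∈ P := by
      push_cast
      exact P.add_mem (P.mul_mem_left _ hrP) (P.mul_mem_left _ hnP)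
    simpa [huv] using this
  obtain ⟨ξ, hξ, hξP⟩ : ∃ ξ ∈ Polynomial.nthRootsFinset q (1 : 𝓞 L), (x : 𝓞 L) - ξ * α ∈ P := by
    rw [← hP.prod_mem_iff, ← hζ.pow_sub_pow_eq_prod_sub_mul (x : 𝓞 L) α hq, hα]
    obtain ⟨c, hc⟩ := hx
    have : (x : 𝓞 L) ^ q - a = r * c := by exact_mod_cast congrArg (Int.cast : ℤ → 𝓞 L) hc
    rw [this]
    exact P.mul_mem_right _ hrP
  have hξq : ξ ^ q = 1 := (Polynomial.mem_nthRootsFinset hq _).mp hξ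
  have hgξ : g • ξ = ξ := by
    have : NeZero q := ⟨hq.ne'⟩
    obtain ⟨i, -, rfl⟩ := hζ.eq_pow_of_pow_eq_one hξq
    rw [smul_pow', hgζ]
  have hξ0 : ξ ≠ 0 := by
    rintro rfl
    simp [hq.ne'] at hξq
  set β := ξ * α
  have hβ : β ^ q = a := by rw [mul_pow, hξq, hα, one_mul]
  have hgβq : (g • β) ^ q = a := by
    rw [← smul_pow', hβ]
    exact map_intCast (MulSemiringAction.toRingHom G (𝓞 L) g) a
  have hne : g • β ≠ β := by
    rw [smul_mul', hgξ]
    exact fun h ↦ hgα (mul_left_cancel₀ hξ0 h)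
  have hgx : (x : 𝓞 L) - g • β ∈ P := by
    have := Ideal.smul_mem_pointwise_smul g _ P hξP
    rw [hgP, smul_sub] at this
    rwa [show g • (x : 𝓞 L) = x from map_intCast (MulSemiringAction.toRingHom G (𝓞 L) g) x]
      at this
  have hsum : ∑ i ∈ Finset.range q, (g • β) ^ i * β ^ (q - 1 - i) = 0 := by
    have := (Commute.all (g • β) β).geom_sum₂_mul q
    rw [hβ, hgβq, sub_self] at this
    exact (mul_eq_zero.mp this).resolve_right (sub_ne_zero.mpr hne)
  have hmk : Ideal.Quotient.mk P (g • β) = Ideal.Quotient.mk P β :=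
    Ideal.Quotient.eq.mpr (by simpa using P.sub_mem hξP hgx)
  have hqβ : (q : 𝓞 L) * β ^ (q - 1) ∈ P := by
    rw [← Ideal.Quotient.eq_zero_iff_mem]
    have := congrArg (Ideal.Quotient.mk P) hsum
    rw [map_sum, map_zero] at this
    simp only [map_mul, map_pow, hmk] at this
    rw [geom_sum₂_self] at this
    simpa using this
  rcases hP.mem_or_mem hqβ with h | h
  · exact not_mem (n := q) (by exact_mod_cast hrq) (by simpa using h)
  · refine not_mem hra ?_
    rw [← hβ]
    exact P.pow_mem_of_mem (hP.mem_of_pow_mem _ h) _ hq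

/-- A prime `p` of `K` of degree one splits completely in the Kummer extension
`L = K(a ^ (1 / q))` if `a` is a `q`-th power modulo `p` and `p ∤ q * a`. -/
theorem exists_finset_primesOver [Finite G] {q : ℕ} (hq : q.Prime) (hG : Nat.card G = q) {ζ : 𝓞 L}
    (hζ : IsPrimitiveRoot ζ q) {g : G}
    (hgζ : g • ζ = ζ) {α : 𝓞 L} {a : ℤ} (hα : α ^ q = a) (hgα : g • α ≠ α)
    {p : Ideal (𝓞 K)} (hp : Prime p) (hr : p.absNorm.Prime)
    (hrq : ¬ p.absNorm ∣ q) (hra : ¬ (p.absNorm : ℤ) ∣ a) {x : ℤ}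
    (hx : (p.absNorm : ℤ) ∣ x ^ q - a) :
    ∃ F : Finset (Ideal (𝓞 L)), F.card = q ∧
      ∀ P ∈ F, Prime P ∧ Ideal.absNorm P = p.absNorm ∧ P.under (𝓞 K) = p := by
  have hp0 : p ≠ ⊥ := hp.ne_zero
  have : p.IsPrime := Ideal.isPrime_of_prime hp
  have : p.IsMaximal := this.isMaximal hp0
  have hfin : (p.primesOver (𝓞 L)).Finite := IsDedekindDomain.primesOver_finite p (𝓞 L)
  have hcard := Ideal.ncard_primesOver_mul_ramificationIdxIn_mul_inertiaDegIn p (𝓞 L) G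
  rw [hG] at hcard
  have hne : (p.primesOver (𝓞 L)).ncard ≠ 1 := by
    obtain ⟨P, hPp, hPo⟩ := (inferInstance : Nonempty (p.primesOver (𝓞 L)))
    have hrP : (p.absNorm : 𝓞 L) ∈ P := by
      have := (Ideal.mem_of_liesOver P p _).mp (Ideal.absNorm_mem p)
      rwa [map_natCast] at this
    have hgP := smul_prime_ne hq.pos hζ hgζ hα hgα hr hrq hra hx hrP
    intro h1
    obtain ⟨Q, hQ⟩ := Set.ncard_eq_one.mp h1
    have h2 : P ∈ p.primesOver (𝓞 L) := ⟨hPp, hPo⟩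
    have h3 : g • P ∈ p.primesOver (𝓞 L) := (g • (⟨P, h2⟩ : p.primesOver (𝓞 L))).2
    rw [hQ] at h2 h3
    exact hgP (h3.trans h2.symm)
  obtain ⟨hn, hef⟩ : (p.primesOver (𝓞 L)).ncard = q ∧
      p.ramificationIdxIn (𝓞 L) * p.inertiaDegIn (𝓞 L) = 1 := by
    have hdvd := (Nat.dvd_prime hq).mp (Dvd.intro _ hcard)
    have hn := hdvd.resolve_left hne
    exact ⟨hn, Nat.eq_of_mul_eq_mul_left hq.pos (by rw [hn] at hcard; lia)⟩
  refine ⟨hfin.toFinset, by rw [← Set.ncard_eq_toFinset_card _ hfin, hn], fun P hP ↦ ?_⟩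
  obtain ⟨hPp, hPo⟩ := (Set.Finite.mem_toFinset hfin).mp hP
  refine ⟨Ideal.prime_of_isPrime (Ideal.ne_bot_of_liesOver_of_ne_bot hp0 P) hPp, ?_,
    hPo.over.symm⟩
  rw [← Ideal.absNorm_pow_inertiaDeg p P, ← Ideal.inertiaDegIn_eq_inertiaDeg p P G,
    Nat.eq_one_of_mul_eq_one_left hef, pow_one]

end Splitting

section Kummer

theorem MulAction.exists_forall_smul_ne {G X ι : Type*} [Group G] [Finite G] [MulAction G X]
    [Fintype ι] {q : ℕ} (hq : 2 ≤ q) (hι : Fintype.card ι ≤ q) (x : ι → X)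
    (hx : ∀ i, q ≤ (MulAction.orbit G (x i)).ncard) : ∃ g : G, ∀ i, g • x i ≠ x i := by
  classical
  have := Fintype.ofFinite G
  by_contra! h
  obtain ⟨i₀, -⟩ := h 1
  let H (i : ι) : Finset G := {g | g • x i = x i ∧ g ≠ 1}
  have hH (i : ι) : q * (H i).card + q ≤ Fintype.card G := by
    have h1 : (H i).card + 1 = Nat.card (MulAction.stabilizer G (x i)) := by
      rw [← Finset.card_insert_of_notMem (s := H i) (a := 1) (by simp [H]),
        Nat.card_eq_fintype_card, Fintype.card_subtype]
      congr 1
      ext g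
      by_cases hg : g = 1 <;> simp [H, hg, MulAction.mem_stabilizer_iff]
    have h2 := (MulAction.stabilizer G (x i)).card_mul_index
    rw [MulAction.index_stabilizer, ← h1, Nat.card_eq_fintype_card] at h2
    nlinarith [hx i]
  have hcover : (Finset.univ.erase (1 : G)) ⊆ Finset.univ.biUnion H := by
    intro g hg
    obtain ⟨i, hi⟩ := h g
    simp only [Finset.mem_biUnion, Finset.mem_univ, true_and]
    exact ⟨i, by simpa [H, hi] using hg⟩
  have hcard := (Finset.card_le_card hcover).trans Finset.card_biUnion_le
  rw [Finset.card_erase_of_mem (Finset.mem_univ _), Finset.card_univ] at hcard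
  have hsum : q * ∑ i, (H i).card + Fintype.card ι * q ≤ Fintype.card ι * Fintype.card G := by
    rw [Finset.mul_sum, ← smul_eq_mul (Fintype.card ι) q, ← smul_eq_mul (Fintype.card ι),
      ← Finset.card_univ, ← Finset.sum_const, ← Finset.sum_const, ← Finset.sum_add_distrib]
    exact Finset.sum_le_sum fun i _ ↦ hH i
  obtain ⟨n, hn⟩ : ∃ n, Fintype.card G = q + n := Nat.exists_eq_add_of_le (by have := hH i₀; lia)
  have h3 : q * (Fintype.card G - 1) ≤ q * ∑ i, (H i).card := Nat.mul_le_mul_left _ hcard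
  have h4 : Fintype.card ι * n ≤ q * n := Nat.mul_le_mul_right _ hι
  rw [hn] at h3 hsum
  obtain ⟨m, rfl⟩ := Nat.exists_eq_add_of_le hq
  rw [show 2 + m + n - 1 = 1 + m + n by lia] at h3
  nlinarith

variable {L : Type*} [Field L] [NumberField L] {q : ℕ} {ζ : L}

theorem notMem_adjoin_of_pow_eq (hq : q.Prime) (hζ : IsPrimitiveRoot ζ q)
    {α : L} {a : ℤ} (hα : α ^ q = a) (ha : ∀ b : ℤ, a ≠ b ^ q) :
    α ∉ IntermediateField.adjoin ℚ {ζ} := by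
  have hirr : Irreducible (Polynomial.X ^ q - Polynomial.C (a : ℚ)) := by
    refine X_pow_sub_C_irreducible_of_prime hq fun b hb ↦ ?_
    obtain ⟨c, rfl⟩ := IsIntegrallyClosed.exists_algebraMap_eq_of_isIntegral_pow (R := ℤ) hq.pos
      (x := b) (by rw [hb]; exact isIntegral_algebraMap (R := ℤ) (x := a))
    simp only [algebraMap_int_eq, eq_intCast] at hb
    exact ha c (by exact_mod_cast hb.symm)
  have hdeg : Module.finrank ℚ (IntermediateField.adjoin ℚ {α}) = q := by
    rw [IntermediateField.adjoin.finrank (Algebra.IsIntegral.isIntegral α),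
      ← minpoly.eq_of_irreducible_of_monic hirr (by simp [hα])
        (Polynomial.monic_X_pow_sub_C _ hq.ne_zero), Polynomial.natDegree_X_pow_sub_C]
  have hdegζ : Module.finrank ℚ (IntermediateField.adjoin ℚ {ζ}) = q - 1 := by
    rw [IntermediateField.adjoin.finrank (Algebra.IsIntegral.isIntegral ζ),
      ← Polynomial.cyclotomic_eq_minpoly_rat hζ hq.pos, Polynomial.natDegree_cyclotomic,
      Nat.totient_prime hq]
  intro hmem
  have hle : IntermediateField.adjoin ℚ {α} ≤ IntermediateField.adjoin ℚ {ζ} := by simpa using hmem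
  have := IntermediateField.finrank_le_of_le_right hle
  have := hq.pos
  lia

theorem exists_forall_pow_apply_eq_mul (hζ : IsPrimitiveRoot ζ q) (hq : q ≠ 0) {σ : L ≃ₐ[ℚ] L}
    (hσ : σ ζ = ζ) {β : L} {c : ℚ} (hβ : β ^ q = algebraMap ℚ L c) :
    ∃ ξ : L, ξ ^ q = 1 ∧ ∀ k : ℕ, (σ ^ k) β = ξ ^ k * β := by
  obtain rfl | hβ0 := eq_or_ne β 0
  · exact ⟨1, by simp⟩
  have hξ : (σ β / β) ^ q = 1 := by
    rw [div_pow, ← map_pow, hβ, AlgEquiv.commutes, div_self]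
    rw [← hβ]
    exact pow_ne_zero _ hβ0
  have : NeZero q := ⟨hq⟩
  obtain ⟨i, -, hi⟩ := hζ.eq_pow_of_pow_eq_one hξ
  refine ⟨σ β / β, hξ, fun k ↦ ?_⟩
  induction k with
  | zero => simp
  | succ k ih =>
    rw [pow_succ', AlgEquiv.mul_apply, ih, map_mul, map_pow]
    have : σ (σ β / β) = σ β / β := by rw [← hi, map_pow, hσ]
    rw [this, pow_succ, mul_assoc, div_mul_cancel₀ _ hβ0]

theorem pow_eq_one_of_apply_eq (hζ : IsPrimitiveRoot ζ q) (hq : q ≠ 0) {σ : L ≃ₐ[ℚ] L}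
    (hσ : σ ζ = ζ) {S : Set L} (hS : Algebra.adjoin ℚ S = ⊤)
    (hSq : ∀ β ∈ S, ∃ c : ℚ, β ^ q = algebraMap ℚ L c) : σ ^ q = 1 := by
  have : ((σ ^ q : L ≃ₐ[ℚ] L) : L →ₐ[ℚ] L) = AlgHom.id ℚ L := by
    refine AlgHom.ext_of_adjoin_eq_top hS fun β hβ ↦ ?_
    obtain ⟨c, hc⟩ := hSq β hβ
    obtain ⟨ξ, hξ, h⟩ := exists_forall_pow_apply_eq_mul hζ hq hσ hc
    simpa [hξ] using h q
  exact AlgEquiv.ext fun x ↦ DFunLike.congr_fun this x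

/-- If at most `q` integers are not `q`-th powers, then some Galois automorphism fixes the `q`-th
roots of unity and moves the `q`-th roots of all these integers. -/
theorem exists_algEquiv_forall_apply_ne [IsGalois ℚ L] (hq : q.Prime)
    (hζ : IsPrimitiveRoot ζ q) {ι : Type*} [Fintype ι] (hι : Fintype.card ι ≤ q) {a : ι → ℤ}
    {α : ι → L} (hα : ∀ i, α i ^ q = a i) (ha : ∀ i, ∀ b : ℤ, a i ≠ b ^ q) :
    ∃ σ : L ≃ₐ[ℚ] L, σ ζ = ζ ∧ ∀ i, σ (α i) ≠ α i := by
  let V : Subgroup (L ≃ₐ[ℚ] L) := (IntermediateField.adjoin ℚ {ζ}).fixingSubgroup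
  have hV (σ : V) : σ.1 ζ = ζ :=
    σ.2 ⟨ζ, IntermediateField.mem_adjoin_simple_self ℚ ζ⟩
  obtain ⟨σ, hσ⟩ := MulAction.exists_forall_smul_ne (G := V) hq.two_le hι α fun i ↦ by
    obtain ⟨τ, hτ⟩ : ∃ τ : V, τ • α i ≠ α i := by
      by_contra! h
      refine notMem_adjoin_of_pow_eq hq hζ (hα i) (ha i) ?_
      rw [← IsGalois.fixedField_fixingSubgroup (IntermediateField.adjoin ℚ {ζ})]
      exact h
    obtain ⟨ξ, hξ, h⟩ := exists_forall_pow_apply_eq_mul hζ hq.ne_zero (hV τ)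
      (c := a i) (by simpa using hα i)
    have hξ1 : ξ ≠ 1 := by
      rintro rfl
      exact hτ (by simpa using! h 1)
    have hα0 : α i ≠ 0 := by
      intro h0
      exact hτ (by simp [h0])
    have := Fact.mk hq
    have hprim : IsPrimitiveRoot ξ q :=
      IsPrimitiveRoot.iff_orderOf.mpr (orderOf_eq_prime hξ hξ1)
    rw [← Finset.card_range q, ← Set.ncard_coe_finset]
    refine Set.ncard_le_ncard_of_injOn (fun k ↦ ξ ^ k * α i) (fun k _ ↦ ⟨τ ^ k, h k⟩) ?_
      (Set.finite_range _)
    intro j hj k hk hjk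
    exact hprim.pow_inj (by simpa using hj) (by simpa using hk) (mul_right_cancel₀ hα0 hjk)
  exact ⟨σ, hV σ, hσ⟩

end Kummer

section Main

theorem exists_prime_not_dvd_prod {L : Type*} [Field L] [NumberField L] [IsGalois ℚ L] {q : ℕ}
    (hq : q.Prime) {ζ : L} (hζ : IsPrimitiveRoot ζ q) {ι : Type*} [Fintype ι] [Nonempty ι]
    (hι : Fintype.card ι ≤ q) {a : ι → ℤ} (ha0 : ∀ i, a i ≠ 0) {α : ι → L}
    (hα : ∀ i, α i ^ q = a i) (ha : ∀ i, ∀ b : ℤ, a i ≠ b ^ q) {S : Set L}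
    (hS : Algebra.adjoin ℚ S = ⊤) (hSq : ∀ β ∈ S, ∃ c : ℚ, β ^ q = algebraMap ℚ L c) :
    ∃ r : ℕ, r.Prime ∧ ∀ x : ℤ, ¬ (r : ℤ) ∣ ∏ i, (x ^ q - a i) := by
  obtain ⟨σ, hσζ, hσα⟩ := exists_algEquiv_forall_apply_ne hq hζ hι hα ha
  have hσ1 : σ ≠ 1 := by
    rintro rfl
    exact hσα (Classical.arbitrary ι) rfl
  have := Fact.mk hq
  let H := Subgroup.zpowers σ
  have hH : Nat.card H = q := by
    rw [Nat.card_zpowers]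
    exact orderOf_eq_prime (pow_eq_one_of_apply_eq hζ hq.ne_zero hσζ hS hSq) hσ1
  let K := FixedPoints.intermediateField (F := ℚ) (E := L) H
  let g : H := ⟨σ, Subgroup.mem_zpowers σ⟩
  have hint : IsIntegral ℤ ζ := hζ.isIntegral hq.pos
  let ζ' : 𝓞 L := ⟨ζ, hint⟩
  have hζ' : IsPrimitiveRoot ζ' q :=
    IsPrimitiveRoot.of_map_of_injective (f := algebraMap (𝓞 L) L) hζ RingOfIntegers.coe_injective
  have hαint (i : ι) : IsIntegral ℤ (α i) :=
    IsIntegral.of_pow hq.pos (by rw [hα i]; exact isIntegral_algebraMap (R := ℤ) (x := a i))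
  let α' (i : ι) : 𝓞 L := ⟨α i, hαint i⟩
  obtain ⟨p, hp, hr, hrB, hF⟩ := exists_prime_not_split (K := K) (L := L)
    (B := q * ∏ i, (a i).natAbs) (q := q)
    (mul_ne_zero hq.ne_zero (Finset.prod_ne_zero_iff.mpr fun i _ ↦ Int.natAbs_ne_zero.mpr (ha0 i)))
    hq.two_le
  refine ⟨p.absNorm, hr, fun x hx ↦ ?_⟩
  obtain ⟨i, -, hi⟩ := (Nat.prime_iff_prime_int.mp hr).exists_mem_finset_dvd hx
  obtain ⟨F, hFq, hFP⟩ := exists_finset_primesOver (G := H) hq hH hζ' (g := g)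
    (RingOfIntegers.ext hσζ) (α := α' i) (a := a i)
    (RingOfIntegers.ext (by simpa [α'] using! hα i))
    (fun h ↦ hσα i (congrArg (algebraMap (𝓞 L) L) h)) hp hr
    (fun h ↦ hrB (h.mul_right _))
    (fun h ↦ hrB (((Int.natCast_dvd.mp h).trans
      (Finset.dvd_prod_of_mem (fun i ↦ (a i).natAbs) (Finset.mem_univ i))).mul_left _)) hi
  exact hF F hFq hFP

open Polynomial in
theorem exists_prime_not_dvd_prod_pow_sub {q : ℕ} (hq : q.Prime) {ι : Type*} [Fintype ι]
    [Nonempty ι] (hι : Fintype.card ι ≤ q) {a : ι → ℤ} (ha0 : ∀ i, a i ≠ 0)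
    (ha : ∀ i, ∀ b : ℤ, a i ≠ b ^ q) :
    ∃ r : ℕ, r.Prime ∧ ∀ x : ℤ, ¬ (r : ℤ) ∣ ∏ i, (x ^ q - a i) := by
  let f : ℚ[X] := cyclotomic q ℚ * ∏ i, (X ^ q - C (a i : ℚ))
  have hf0 : f ≠ 0 := mul_ne_zero (cyclotomic_ne_zero q ℚ)
    (Finset.prod_ne_zero_iff.mpr fun i _ ↦ X_pow_sub_C_ne_zero hq.pos _)
  let L := SplittingField f
  have : NumberField L := { to_charZero := inferInstance, to_finiteDimensional := inferInstance }
  have : Normal ℚ L := .of_isSplittingField (hFEp := .splittingField f) f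
  have : IsGalois ℚ L := ⟨⟩
  have hroot {g : ℚ[X]} (hgf : g ∣ f) (hg : g.degree ≠ 0) : ∃ x : L, aeval x g = 0 := by
    obtain ⟨x, hx⟩ := ((SplittingField.splits f).of_dvd (Polynomial.map_ne_zero hf0)
      (Polynomial.map_dvd (algebraMap ℚ L) hgf)).exists_eval_eq_zero (by rwa [degree_map])
    exact ⟨x, by rwa [eval_map_algebraMap] at hx⟩
  obtain ⟨ζ, hζ⟩ := hroot (Dvd.intro _ rfl) (degree_cyclotomic_pos q ℚ hq.pos).ne'
  replace hζ : IsPrimitiveRoot ζ q := by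
    have : NeZero (q : L) := ⟨Nat.cast_ne_zero.mpr hq.ne_zero⟩
    rw [← isRoot_cyclotomic_iff, ← map_cyclotomic q (algebraMap ℚ L), IsRoot, eval_map_algebraMap,
      hζ]
  have hα (i : ι) : ∃ α : L, α ^ q = a i := by
    obtain ⟨α, hα⟩ := hroot (g := X ^ q - C (a i : ℚ))
      ((Finset.dvd_prod_of_mem _ (Finset.mem_univ i)).mul_left _)
      (by rw [degree_X_pow_sub_C hq.pos]; exact_mod_cast hq.ne_zero)
    exact ⟨α, by simpa [sub_eq_zero] using hα⟩
  choose α hα using hα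
  refine exists_prime_not_dvd_prod hq hζ hι ha0 hα ha (SplittingField.adjoin_rootSet f)
    fun β hβ ↦ ?_
  have hβ0 := (mem_rootSet.mp hβ).2
  rw [map_mul, map_prod, mul_eq_zero, Finset.prod_eq_zero_iff] at hβ0
  rcases hβ0 with h | ⟨i, -, h⟩
  · have := aeval_eq_zero_of_dvd_aeval_eq_zero (cyclotomic.dvd_X_pow_sub_one q ℚ) h
    exact ⟨1, by simpa [sub_eq_zero] using this⟩
  · exact ⟨a i, by simpa [sub_eq_zero] using h⟩

end Main

end

/-- If `l ≤ q` and `∏ j (x^q - a j)` has a root modulo every positive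
integer, then some `a j` is a perfect q-th power. -/
theorem stmt5 (q : ℕ) (hq : q.Prime) (hq_odd : Odd q)
    (l : ℕ) (hl1 : 1 ≤ l) (hlq : l ≤ q) (a : Fin l → ℤ)
    (ha0 : ∀ j, a j ≠ 0)
    (h : ∀ m : ℕ, 0 < m → ∃ x : ℤ, (m : ℤ) ∣ ∏ j, (x ^ q - a j)) :
    ∃ j, ∃ b : ℤ, a j = b ^ q := by
  by_contra! ha
  have : Nonempty (Fin l) := ⟨⟨0, hl1⟩⟩
  obtain ⟨r, hr, hr'⟩ := exists_prime_not_dvd_prod_pow_sub hq (by simpa using hlq) ha0 ha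
  obtain ⟨x, hx⟩ := h r hr.pos
  exact hr' x hx
end

section
/- Let q be an odd prime, let a_1, a_2, …, a_l be non-zero q-free integers, none equal to 1 or −1, and let c_1, c_2, …, c_l be integers with 1 ≤ c_j ≤ q − 1 for each j. Suppose b_1, b_2, …, b_l are non-zero q-free integers such that for each j there exists an integer r_j with a_j^{c_j} = b_j · r_j^q (so that b_j is the q-free part of a_j^{c_j}). Then the polynomial (x^q − a_1)(x^q − a_2)⋯(x^q − a_l) has a root modulo every positive integer if and only if the polynomial (x^q − b_1)(x^q − b_2)⋯(x^q − b_l) has a root modulo every positive integer. -/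
theorem exists_pow_eq_iff_of_pow_eq_mul_pow {K : Type*} [Field K] {a b r : K} {q c : ℕ}
    (ha : a ≠ 0) (hcq : c.Coprime q) (h : a ^ c = b * r ^ q) (hr : r ≠ 0) :
    (∃ y, y ^ q = a) ↔ ∃ z, z ^ q = b := by
  constructor
  · rintro ⟨y, rfl⟩
    refine ⟨y ^ c / r, ?_⟩
    rw [div_pow, ← pow_mul, mul_comm c q, pow_mul, h, mul_div_cancel_right₀ _ (pow_ne_zero _ hr)]
  · rintro ⟨z, rfl⟩
    rw [← mul_pow] at h
    refine ⟨(z * r) ^ (c.gcdA q) * a ^ (c.gcdB q), ?_⟩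
    have bezout := Nat.gcd_eq_gcd_ab c q
    rw [hcq.gcd_eq_one, Nat.cast_one] at bezout
    calc ((z * r) ^ (c.gcdA q) * a ^ (c.gcdB q)) ^ q
        = ((z * r) ^ q) ^ (c.gcdA q) * a ^ ((q : ℤ) * c.gcdB q) := by
          rw [mul_pow, ← zpow_natCast, ← zpow_mul, mul_comm (c.gcdA q), zpow_mul, zpow_natCast,
            ← zpow_natCast (a ^ _), ← zpow_mul, mul_comm (c.gcdB q)]
      _ = a ^ ((c : ℤ) * c.gcdA q + q * c.gcdB q) := by
          rw [← h, zpow_add₀ ha, zpow_mul a c, zpow_natCast]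
      _ = a := by rw [← bezout, zpow_one]

theorem PadicInt.exists_pow_eq_intCast_iff {p : ℕ} [Fact p.Prime] {q : ℕ} (hq : q ≠ 0) (a : ℤ) :
    (∃ y : ℤ_[p], y ^ q = a) ↔ ∃ y : ℚ_[p], y ^ q = a := by
  constructor
  · rintro ⟨y, hy⟩
    exact ⟨y, by exact_mod_cast congrArg ((↑) : ℤ_[p] → ℚ_[p]) hy⟩
  · rintro ⟨y, hy⟩
    have hy1 : ‖y‖ ≤ 1 := by
      rw [← pow_le_one_iff_of_nonneg (norm_nonneg y) hq, ← norm_pow, hy]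
      exact Padic.norm_int_le_one a
    exact ⟨⟨y, hy1⟩, PadicInt.ext (by push_cast; exact hy)⟩

theorem exists_dvd_prod_pow_sub_iff_zmod {ι : Type*} [Fintype ι] (q m : ℕ) (a : ι → ℤ) :
    (∃ x : ℤ, (m : ℤ) ∣ ∏ j, (x ^ q - a j)) ↔ ∃ x : ZMod m, ∏ j, (x ^ q - a j) = 0 := by
  rw [ZMod.intCast_surjective.exists]
  refine exists_congr fun x => ?_
  rw [← ZMod.intCast_zmod_eq_zero_iff_dvd]
  push_cast
  rfl

theorem forall_exists_dvd_prod_pow_sub_iff {ι : Type*} [Fintype ι] (q : ℕ) (a : ι → ℤ) :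
    (∀ m : ℕ, 0 < m → ∃ x : ℤ, (m : ℤ) ∣ ∏ j, (x ^ q - a j)) ↔
      ∀ (p : ℕ) [Fact p.Prime], ∃ j, ∃ y : ℤ_[p], y ^ q = a j := by
  constructor
  · intro h p hp
    let f : ℤ_[p] → ℤ_[p] := fun x => ∏ j, (x ^ q - a j)
    have hf : Continuous f := by fun_prop
    obtain ⟨y, -, hy⟩ := isCompact_univ.exists_isMinOn Set.univ_nonempty hf.norm.continuousOn
    have hfy : f y = 0 := by
      by_contra hne
      obtain ⟨n, hn⟩ := PadicInt.exists_pow_neg_lt p (norm_pos_iff.2 hne)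
      obtain ⟨x, hx⟩ := h (p ^ n) (pow_pos hp.out.pos n)
      rw [Nat.cast_pow, ← PadicInt.norm_int_le_pow_iff_dvd] at hx
      push_cast at hx
      exact (hy (Set.mem_univ (x : ℤ_[p]))).not_gt (hx.trans_lt hn)
    obtain ⟨j, -, hj⟩ := Finset.prod_eq_zero_iff.1 hfy
    exact ⟨j, y, sub_eq_zero.1 hj⟩
  · intro h m
    simp only [exists_dvd_prod_pow_sub_iff_zmod]
    induction m using Nat.recOnPosPrimePosCoprime with
    | prime_pow p n hp hn =>
      intro _
      have : Fact p.Prime := ⟨hp⟩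
      obtain ⟨j, y, hy⟩ := h p
      refine ⟨PadicInt.toZModPow n y, Finset.prod_eq_zero (Finset.mem_univ j) ?_⟩
      rw [← map_pow, hy, map_intCast, sub_self]
    | zero => intro h0; exact absurd h0 (lt_irrefl 0)
    | one => exact fun _ => ⟨0, Subsingleton.elim _ _⟩
    | coprime m n hm hn hmn ihm ihn =>
      intro _
      obtain ⟨x, hx⟩ := ihm (by lia)
      obtain ⟨y, hy⟩ := ihn (by lia)
      let e := ZMod.chineseRemainder hmn
      refine ⟨e.symm (x, y), e.injective ?_⟩
      simp only [map_prod, map_sub, map_pow, map_intCast, map_zero, RingEquiv.apply_symm_apply]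
      ext
      · simpa [Prod.fst_prod] using hx
      · simpa [Prod.snd_prod] using hy

/-- Intersectivity of `∏ j (x^q - a j)` is invariant under replacing each
`a j` by the q-free part of `a j ^ (c j)` with `1 ≤ c j ≤ q - 1`. -/
theorem stmt6 (q : ℕ) (hq : q.Prime) (hq_odd : Odd q)
    (l : ℕ) (a b : Fin l → ℤ)
    (ha0 : ∀ j, a j ≠ 0)
    (haqf : ∀ j, ∀ r : ℕ, r.Prime → ¬ ((r : ℤ) ^ q ∣ a j))
    (ha1 : ∀ j, a j ≠ 1) (ham1 : ∀ j, a j ≠ -1)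
    (c : Fin l → ℕ) (hc1 : ∀ j, 1 ≤ c j) (hc2 : ∀ j, c j ≤ q - 1)
    (hb0 : ∀ j, b j ≠ 0)
    (hbqf : ∀ j, ∀ r : ℕ, r.Prime → ¬ ((r : ℤ) ^ q ∣ b j))
    (hab : ∀ j, ∃ r : ℤ, a j ^ (c j) = b j * r ^ q) :
    (∀ m : ℕ, 0 < m → ∃ x : ℤ, (m : ℤ) ∣ ∏ j, (x ^ q - a j)) ↔
    (∀ m : ℕ, 0 < m → ∃ x : ℤ, (m : ℤ) ∣ ∏ j, (x ^ q - b j)) := by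
  have hq0 : q ≠ 0 := hq.ne_zero
  rw [forall_exists_dvd_prod_pow_sub_iff, forall_exists_dvd_prod_pow_sub_iff]
  refine forall₂_congr fun p hp => exists_congr fun j => ?_
  rw [PadicInt.exists_pow_eq_intCast_iff hq0, PadicInt.exists_pow_eq_intCast_iff hq0]
  obtain ⟨r, hr⟩ := hab j
  have hr0 : r ≠ 0 := by
    rintro rfl
    rw [zero_pow hq0, mul_zero] at hr
    exact pow_ne_zero _ (ha0 j) hr
  have hcq : (c j).Coprime q :=
    (Nat.coprime_of_lt_prime (Nat.one_le_iff_ne_zero.1 (hc1 j))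
      ((hc2 j).trans_lt (Nat.pred_lt hq0)) hq).symm
  exact exists_pow_eq_iff_of_pow_eq_mul_pow (r := (r : ℚ_[p])) (Int.cast_ne_zero.2 (ha0 j)) hcq
    (by exact_mod_cast hr) (Int.cast_ne_zero.2 hr0)
end

section
/- Let p_1 and p_2 be two distinct primes, both different from 3. Then the polynomial f_1(x) = (x^3 − p_1)(x^3 − p_2)(x^3 − p_1 p_2)(x^3 − p_1^2 p_2) has a root modulo every positive integer if and only if the following two conditions hold: (1) some element of the set {p_1, p_2, p_1 p_2, p_1^2 p_2} is a cube modulo 27; and (2) p_1 is a cube modulo p_2 and p_2 is a cube modulo p_1. -/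
/-- A function on `ℤ` compatible with all congruences that vanishes somewhere modulo every prime
power vanishes somewhere modulo every positive integer. -/
theorem exists_dvd_of_forall_prime_pow {f : ℤ → ℤ} (hf : ∀ x y, x - y ∣ f x - f y)
    (h : ∀ q : ℕ, q.Prime → ∀ k : ℕ, ∃ x, (q : ℤ) ^ k ∣ f x) (m : ℕ) (hm : 0 < m) :
    ∃ x, (m : ℤ) ∣ f x := by
  induction m using Nat.recOnPrimeCoprime with
  | zero => exact absurd hm (lt_irrefl 0)
  | prime_pow q k hq =>
    obtain ⟨x, hx⟩ := h q hq k
    exact ⟨x, by exact_mod_cast hx⟩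
  | coprime a b ha hb hab iha ihb =>
    obtain ⟨x, hx⟩ := iha (by omega)
    obtain ⟨y, hy⟩ := ihb (by omega)
    have hc : IsCoprime (a : ℤ) b := Nat.isCoprime_iff_coprime.mpr hab
    obtain ⟨u, v, huv⟩ := id hc
    refine ⟨x * (v * b) + y * (u * a), ?_⟩
    push_cast
    refine hc.mul_dvd ?_ ?_
    · refine (dvd_sub_left hx).mp (dvd_trans ⟨u * (y - x), ?_⟩ (hf _ _))
      linear_combination x * huv
    · refine (dvd_sub_left hy).mp (dvd_trans ⟨v * (x - y), ?_⟩ (hf _ _))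
      linear_combination y * huv

/-- If `r` is coprime to the prime `q`, then `c + r t` vanishes modulo `q` for some `t`. -/
theorem exists_dvd_add_mul {q r : ℤ} (h : IsCoprime q r) (c : ℤ) : ∃ t, q ∣ c + r * t := by
  obtain ⟨u, v, huv⟩ := h
  exact ⟨-c * v, c * u, by linear_combination (-c) * huv⟩

/-- Hensel lifting for cube roots away from `3`. -/
theorem exists_pow_dvd_cube_sub {q : ℕ} (hq : q.Prime) (h3 : q ≠ 3) {a x : ℤ}
    (ha : ¬ (q : ℤ) ∣ a) (hx : (q : ℤ) ∣ x ^ 3 - a) (k : ℕ) :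
    ∃ y : ℤ, (q : ℤ) ^ k ∣ y ^ 3 - a := by
  have hq' : Prime (q : ℤ) := Nat.prime_iff_prime_int.mp hq
  suffices H : ∀ k : ℕ, ∃ y : ℤ, (q : ℤ) ^ (k + 1) ∣ y ^ 3 - a by
    obtain ⟨y, hy⟩ := H k
    exact ⟨y, (pow_dvd_pow _ k.le_succ).trans hy⟩
  clear k
  intro k
  induction k with
  | zero => exact ⟨x, by simpa using hx⟩
  | succ k ih =>
    obtain ⟨y, hy⟩ := ih
    have hqy : ¬ (q : ℤ) ∣ y := fun h => ha <|
      (dvd_sub_right (dvd_pow h three_ne_zero)).mp ((dvd_pow_self _ k.succ_ne_zero).trans hy)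
    have hq3 : ¬ (q : ℤ) ∣ 3 := fun h =>
      h3 ((Nat.prime_dvd_prime_iff_eq hq Nat.prime_three).mp (by exact_mod_cast h))
    have hco : IsCoprime (q : ℤ) (3 * y ^ 2) :=
      ((Prime.coprime_iff_not_dvd hq').mpr hq3).mul_right
        ((Prime.coprime_iff_not_dvd hq').mpr hqy).pow_right
    obtain ⟨c, hc⟩ := hy
    obtain ⟨t, d, hd⟩ := exists_dvd_add_mul hco c
    refine ⟨y + t * q ^ (k + 1), d + 3 * y * t ^ 2 * q ^ k + t ^ 3 * q ^ (2 * k + 1), ?_⟩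
    linear_combination hc + (q : ℤ) ^ (k + 1) * hd

/-- Hensel lifting for cube roots at `3`. -/
theorem exists_three_pow_dvd_cube_sub {a x : ℤ} (ha : ¬ (3 : ℤ) ∣ a) (hx : 27 ∣ x ^ 3 - a)
    (k : ℕ) : ∃ y : ℤ, (3 : ℤ) ^ k ∣ y ^ 3 - a := by
  suffices H : ∀ k : ℕ, ∃ y : ℤ, (3 : ℤ) ^ (k + 3) ∣ y ^ 3 - a by
    obtain ⟨y, hy⟩ := H k
    exact ⟨y, (pow_dvd_pow _ (Nat.le_add_right k 3)).trans hy⟩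
  clear k
  intro k
  induction k with
  | zero => exact ⟨x, by simpa using hx⟩
  | succ k ih =>
    obtain ⟨y, hy⟩ := ih
    have h3y : ¬ (3 : ℤ) ∣ y := fun h => ha <|
      (dvd_sub_right (dvd_pow h three_ne_zero)).mp ((dvd_pow_self _ (by omega)).trans hy)
    have hco : IsCoprime (3 : ℤ) (y ^ 2) :=
      ((Prime.coprime_iff_not_dvd Int.prime_three).mpr h3y).pow_right
    obtain ⟨c, hc⟩ := hy
    obtain ⟨t, d, hd⟩ := exists_dvd_add_mul hco c
    refine ⟨y + t * 3 ^ (k + 2), d + y * t ^ 2 * 3 ^ (k + 1) + t ^ 3 * 3 ^ (2 * k + 2), ?_⟩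
    linear_combination hc + (3 : ℤ) ^ (k + 3) * hd

/-- In a cyclic group, one of `a`, `b`, `ab`, `a²b` is a cube. -/
theorem IsCyclic.exists_cube_eq {G : Type*} [Group G] [IsCyclic G] (a b : G) :
    ∃ x : G, x ^ 3 = a ∨ x ^ 3 = b ∨ x ^ 3 = a * b ∨ x ^ 3 = a ^ 2 * b := by
  obtain ⟨g, hg⟩ := IsCyclic.exists_generator (α := G)
  obtain ⟨i, rfl⟩ := Subgroup.mem_zpowers_iff.mp (hg a)
  obtain ⟨j, rfl⟩ := Subgroup.mem_zpowers_iff.mp (hg b)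
  have key : ∃ n : ℤ, n * 3 = i ∨ n * 3 = j ∨ n * 3 = i + j ∨ n * 3 = i * 2 + j := by
    have h : i % 3 = 0 ∨ j % 3 = 0 ∨ (i + j) % 3 = 0 ∨ (i * 2 + j) % 3 = 0 := by
      have hi : i % 3 = 0 ∨ i % 3 = 1 ∨ i % 3 = 2 := by omega
      have hj : j % 3 = 0 ∨ j % 3 = 1 ∨ j % 3 = 2 := by omega
      rcases hi with hi | hi | hi <;> rcases hj with hj | hj | hj <;> omega
    rcases h with h | h | h | h
    · exact ⟨i / 3, by omega⟩
    · exact ⟨j / 3, by omega⟩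
    · exact ⟨(i + j) / 3, by omega⟩
    · exact ⟨(i * 2 + j) / 3, by omega⟩
  obtain ⟨n, hn⟩ := key
  refine ⟨g ^ n, ?_⟩
  simp only [← zpow_natCast, ← zpow_mul, ← zpow_add]
  push_cast
  rcases hn with h | h | h | h <;> simp [h]

/-- Modulo a prime `q`, one of `a`, `b`, `ab`, `a²b` is a cube, for `a` and `b` prime to `q`. -/
theorem exists_prime_dvd_cube_sub {q : ℕ} (hq : q.Prime) {a b : ℤ} (ha : ¬ (q : ℤ) ∣ a)
    (hb : ¬ (q : ℤ) ∣ b) :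
    ∃ c ∈ ({a, b, a * b, a ^ 2 * b} : Set ℤ), ∃ x : ℤ, (q : ℤ) ∣ x ^ 3 - c := by
  have := Fact.mk hq
  rw [← ZMod.intCast_zmod_eq_zero_iff_dvd] at ha hb
  obtain ⟨u, hu⟩ := IsCyclic.exists_cube_eq (Units.mk0 (a : ZMod q) ha) (Units.mk0 (b : ZMod q) hb)
  obtain ⟨x, hx⟩ := ZMod.intCast_surjective (u : ZMod q)
  simp only [Units.ext_iff, Units.val_pow_eq_pow_val, Units.val_mul, Units.val_mk0, ← hx] at hu
  have key (c : ℤ) (h : (x : ZMod q) ^ 3 = c) : ∃ x : ℤ, (q : ℤ) ∣ x ^ 3 - c :=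
    ⟨x, by rw [← ZMod.intCast_zmod_eq_zero_iff_dvd]; push_cast; rw [h, sub_self]⟩
  rcases hu with h | h | h | h
  · exact ⟨a, by simp, key _ h⟩
  · exact ⟨b, by simp, key _ h⟩
  · exact ⟨a * b, by simp, key _ (by exact_mod_cast h)⟩
  · exact ⟨a ^ 2 * b, by simp, key _ (by exact_mod_cast h)⟩

theorem Prime.pow_dvd_or_pow_dvd_of_pow_add_dvd_mul {p : ℤ} (hp : Prime p) (m n : ℕ) {a b : ℤ}
    (h : p ^ (m + n) ∣ a * b) : p ^ m ∣ a ∨ p ^ n ∣ b := by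
  induction m generalizing a with
  | zero => simp
  | succ m ih =>
    by_cases hpa : p ∣ a
    · obtain ⟨c, rfl⟩ := hpa
      have : p ^ (m + n) ∣ c * b := by
        rw [Nat.add_right_comm, pow_succ', mul_assoc] at h
        exact (mul_dvd_mul_iff_left hp.ne_zero).mp h
      refine (ih this).imp_left fun h => ?_
      rw [pow_succ']
      exact mul_dvd_mul_left p h
    · exact Or.inr ((pow_dvd_pow p (Nat.le_add_left n (m + 1))).trans
        (hp.pow_dvd_of_dvd_mul_left _ hpa h))

/-- If `p ∣ b` and `b` is a cube modulo `p³`, then `p³ ∣ b`. -/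
theorem Prime.cube_dvd_of_cube_dvd_cube_sub {p b x : ℤ} (hp : Prime p) (hb : p ∣ b)
    (h : p ^ 3 ∣ x ^ 3 - b) : p ^ 3 ∣ b := by
  have hx : p ∣ x := hp.dvd_of_dvd_pow <|
    (dvd_sub_left hb).mp ((dvd_pow_self p three_ne_zero).trans h)
  exact (dvd_sub_right (pow_dvd_pow_of_dvd hx 3)).mp h

/-- If the product `(x³-a)(x³-b)(x³-ab)(x³-a²b)` has a root modulo every positive integer, then
one of `a`, `b`, `ab`, `a²b` is a cube modulo `p³`, for every prime `p`. -/
theorem exists_cube_dvd_cube_sub {a b : ℤ} (h : ∀ m : ℕ, 0 < m → ∃ x : ℤ,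
      (m : ℤ) ∣ (x ^ 3 - a) * (x ^ 3 - b) * (x ^ 3 - a * b) * (x ^ 3 - a ^ 2 * b))
    {p : ℕ} (hp : p.Prime) :
    ∃ c ∈ ({a, b, a * b, a ^ 2 * b} : Set ℤ), ∃ x : ℤ, (p : ℤ) ^ 3 ∣ x ^ 3 - c := by
  have hp' : Prime (p : ℤ) := Nat.prime_iff_prime_int.mp hp
  obtain ⟨x, hx⟩ := h (p ^ (3 + 3 + 3 + 3)) (pow_pos hp.pos _)
  rw [Nat.cast_pow] at hx
  rcases hp'.pow_dvd_or_pow_dvd_of_pow_add_dvd_mul _ _ hx with hx | hx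
  · rcases hp'.pow_dvd_or_pow_dvd_of_pow_add_dvd_mul _ _ hx with hx | hx
    · rcases hp'.pow_dvd_or_pow_dvd_of_pow_add_dvd_mul _ _ hx with hx | hx
      · exact ⟨a, by simp, x, hx⟩
      · exact ⟨b, by simp, x, hx⟩
    · exact ⟨a * b, by simp, x, hx⟩
  · exact ⟨a ^ 2 * b, by simp, x, hx⟩


/-- Criterion for `(x³-p₁)(x³-p₂)(x³-p₁p₂)(x³-p₁²p₂)` to have roots modulo
every positive integer. -/
theorem stmt7 (p₁ p₂ : ℕ) (hp₁ : p₁.Prime) (hp₂ : p₂.Prime)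
    (hne : p₁ ≠ p₂) (h3₁ : p₁ ≠ 3) (h3₂ : p₂ ≠ 3) :
    (∀ m : ℕ, 0 < m → ∃ x : ℤ,
      (m : ℤ) ∣ (x ^ 3 - p₁) * (x ^ 3 - p₂) * (x ^ 3 - p₁ * p₂) *
        (x ^ 3 - p₁ ^ 2 * p₂)) ↔
    ((∃ a ∈ ({(p₁ : ℤ), (p₂ : ℤ), (p₁ : ℤ) * p₂, (p₁ : ℤ) ^ 2 * p₂} : Set ℤ),
        ∃ x : ℤ, (27 : ℤ) ∣ x ^ 3 - a) ∧
     ((∃ x : ℤ, (p₂ : ℤ) ∣ x ^ 3 - p₁) ∧ (∃ x : ℤ, (p₁ : ℤ) ∣ x ^ 3 - p₂))) := by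
  have hp₁' : Prime (p₁ : ℤ) := Nat.prime_iff_prime_int.mp hp₁
  have hp₂' : Prime (p₂ : ℤ) := Nat.prime_iff_prime_int.mp hp₂
  have not_dvd {q p : ℕ} (hq : q.Prime) (hp : p.Prime) (hqp : q ≠ p) : ¬ (q : ℤ) ∣ p := fun h =>
    hqp ((Nat.prime_dvd_prime_iff_eq hq hp).mp (by exact_mod_cast h))
  have h₁₂ := not_dvd hp₁ hp₂ hne
  have h₂₁ := not_dvd hp₂ hp₁ hne.symm
  constructor
  · intro h
    refine ⟨by simpa using exists_cube_dvd_cube_sub h Nat.prime_three, ?_, ?_⟩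
    · obtain ⟨c, hc, x, hx⟩ := exists_cube_dvd_cube_sub h hp₂
      have contra (r : ℤ) (hr : ¬ (p₂ : ℤ) ∣ r) (hx : (p₂ : ℤ) ^ 3 ∣ x ^ 3 - r * p₂) : False := by
        have h := hp₂'.cube_dvd_of_cube_dvd_cube_sub (dvd_mul_left _ _) hx
        rw [pow_succ] at h
        exact hr ((dvd_pow_self _ two_ne_zero).trans ((mul_dvd_mul_iff_right hp₂'.ne_zero).mp h))
      rcases hc with rfl | rfl | rfl | rfl
      · exact ⟨x, (dvd_pow_self _ three_ne_zero).trans hx⟩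
      · exact (contra 1 hp₂'.not_dvd_one (by simpa using hx)).elim
      · exact (contra _ h₂₁ hx).elim
      · exact (contra _ (fun h => h₂₁ (hp₂'.dvd_of_dvd_pow h)) hx).elim
    · obtain ⟨c, hc, x, hx⟩ := exists_cube_dvd_cube_sub h hp₁
      have contra (r : ℤ) (hr : ¬ (p₁ : ℤ) ∣ r) (e : ℕ) (he : e ≠ 0) (he' : e < 3)
          (hx : (p₁ : ℤ) ^ 3 ∣ x ^ 3 - p₁ ^ e * r) : False := by
        have h := hp₁'.cube_dvd_of_cube_dvd_cube_sub
          (dvd_mul_of_dvd_left (dvd_pow_self _ he) _) hx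
        have h := (pow_dvd_pow (p₁ : ℤ) (Nat.succ_le_of_lt he')).trans h
        rw [pow_succ] at h
        exact hr ((mul_dvd_mul_iff_left (pow_ne_zero _ hp₁'.ne_zero)).mp h)
      rcases hc with rfl | rfl | rfl | rfl
      · exact (contra 1 hp₁'.not_dvd_one 1 (by simp) (by simp) (by simpa using hx)).elim
      · exact ⟨x, (dvd_pow_self _ three_ne_zero).trans hx⟩
      · exact (contra _ h₁₂ 1 (by simp) (by simp) (by simpa using hx)).elim
      · exact (contra _ h₁₂ 2 (by simp) (by simp) hx).elim
  · rintro ⟨⟨a, ha, x, hx⟩, ⟨y, hy⟩, z, hz⟩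
    have not_dvd_mem {q : ℤ} (hq : Prime q) (h₁ : ¬ q ∣ p₁) (h₂ : ¬ q ∣ p₂) {c : ℤ}
        (hc : c ∈ ({(p₁ : ℤ), (p₂ : ℤ), (p₁ : ℤ) * p₂, (p₁ : ℤ) ^ 2 * p₂} : Set ℤ)) :
        ¬ q ∣ c := by
      rcases hc with rfl | rfl | rfl | rfl
      · exact h₁
      · exact h₂
      · exact hq.not_dvd_mul h₁ h₂
      · exact hq.not_dvd_mul (fun h => h₁ (hq.dvd_of_dvd_pow h)) h₂
    refine exists_dvd_of_forall_prime_pow (f := fun x => (x ^ 3 - (p₁ : ℤ)) * (x ^ 3 - p₂) *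
      (x ^ 3 - p₁ * p₂) * (x ^ 3 - p₁ ^ 2 * p₂)) (fun x y => ?_) (fun q hq k => ?_)
    · have := Polynomial.sub_dvd_eval_sub x y ((Polynomial.X ^ 3 - Polynomial.C (p₁ : ℤ)) *
        (Polynomial.X ^ 3 - Polynomial.C (p₂ : ℤ)) *
        (Polynomial.X ^ 3 - Polynomial.C ((p₁ : ℤ) * p₂)) *
        (Polynomial.X ^ 3 - Polynomial.C ((p₁ : ℤ) ^ 2 * p₂)))
      simpa only [Polynomial.eval_mul, Polynomial.eval_sub, Polynomial.eval_pow,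
        Polynomial.eval_X, Polynomial.eval_C] using this
    suffices H : ∃ c ∈ ({(p₁ : ℤ), (p₂ : ℤ), (p₁ : ℤ) * p₂, (p₁ : ℤ) ^ 2 * p₂} : Set ℤ),
        ∃ w : ℤ, (q : ℤ) ^ k ∣ w ^ 3 - c by
      obtain ⟨c, hc, w, hw⟩ := H
      refine ⟨w, ?_⟩
      rcases hc with rfl | rfl | rfl | rfl
      · exact ((hw.mul_right _).mul_right _).mul_right _
      · exact ((hw.mul_left _).mul_right _).mul_right _
      · exact (hw.mul_left _).mul_right _
      · exact hw.mul_left _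
    by_cases h3 : q = 3
    · subst h3
      exact ⟨a, ha, exists_three_pow_dvd_cube_sub
        (not_dvd_mem Int.prime_three (not_dvd hq hp₁ h3₁.symm) (not_dvd hq hp₂ h3₂.symm) ha) hx k⟩
    by_cases hq₁ : q = p₁
    · subst hq₁
      exact ⟨p₂, by simp, exists_pow_dvd_cube_sub hq h3 h₁₂ hz k⟩
    by_cases hq₂ : q = p₂
    · subst hq₂
      exact ⟨p₁, by simp, exists_pow_dvd_cube_sub hq h3 h₂₁ hy k⟩
    have hq₁' := not_dvd hq hp₁ hq₁
    have hq₂' := not_dvd hq hp₂ hq₂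
    obtain ⟨c, hc, w, hw⟩ := exists_prime_dvd_cube_sub hq hq₁' hq₂'
    exact ⟨c, hc, exists_pow_dvd_cube_sub hq h3
      (not_dvd_mem (Nat.prime_iff_prime_int.mp hq) hq₁' hq₂' hc) hw k⟩
end

section
/- Let p_1 and p_2 be two distinct primes, both different from 5. Then the polynomial f(x) = (x^5 − p_1)(x^5 − p_2)(x^5 − p_1 p_2)(x^5 − p_1^2 p_2)(x^5 − p_1 p_2^2)(x^5 − p_1^4 p_2) has a root modulo every positive integer if and only if the following two conditions hold: (1) some element of the set {p_1, p_2, p_1 p_2, p_1^2 p_2, p_1 p_2^2, p_1^4 p_2} is a fifth power modulo 3125; and (2) p_1 is a fifth power modulo p_2 and p_2 is a fifth power modulo p_1. -/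
/-- A linear congruence modulo a prime is solvable when the coefficient is a unit. -/
lemma exists_prime_dvd_add_mul {q : ℤ} (hq : Prime q) {u : ℤ} (hu : ¬ q ∣ u) (c : ℤ) :
    ∃ t, q ∣ c + u * t := by
  obtain ⟨r, s, h⟩ := (hq.coprime_iff_not_dvd.2 hu)
  exact ⟨-(s * c), r * c, by linear_combination -c * h⟩

/-- Roots of non-multiples of `q` modulo powers of `q` are not multiples of `q`. -/
lemma not_dvd_of_dvd_pow_sub {q a x : ℤ} (ha : ¬ q ∣ a) {n k : ℕ}
    (hn : n ≠ 0) (hk : k ≠ 0) (h : q ^ k ∣ x ^ n - a) : ¬ q ∣ x := fun hx =>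
  ha ((dvd_sub_right (dvd_pow hx hn)).1 ((dvd_pow_self q hk).trans h))

/-- Hensel lifting of fifth roots away from `5`. -/
lemma exists_prime_pow_dvd_fifth_pow_sub {q : ℤ} (hq : Prime q) (h5 : ¬ q ∣ 5) {a : ℤ}
    (ha : ¬ q ∣ a) (h : ∃ x : ℤ, q ∣ x ^ 5 - a) (k : ℕ) : ∃ x : ℤ, q ^ k ∣ x ^ 5 - a := by
  suffices H : ∀ n : ℕ, ∃ x : ℤ, q ^ (n + 1) ∣ x ^ 5 - a from
    (H k).imp fun x hx => (pow_dvd_pow q k.le_succ).trans hx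
  intro n
  induction n with
  | zero => simpa using h
  | succ n ih =>
    obtain ⟨x, hx⟩ := ih
    have hqx := not_dvd_of_dvd_pow_sub ha (by norm_num) n.succ_ne_zero hx
    obtain ⟨c, hc⟩ := hx
    have hu : ¬ q ∣ 5 * x ^ 4 := fun hd =>
      (hq.dvd_or_dvd hd).elim h5 fun hxd => hqx (hq.dvd_of_dvd_pow hxd)
    obtain ⟨t, d, hd⟩ := exists_prime_dvd_add_mul hq hu c
    refine ⟨x + q ^ (n + 1) * t, d + q ^ n * (10 * x ^ 3 * t ^ 2
      + 10 * x ^ 2 * t ^ 3 * q ^ (n + 1) + 5 * x * t ^ 4 * q ^ (2 * (n + 1))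
      + t ^ 5 * q ^ (3 * (n + 1))), ?_⟩
    linear_combination hc + q ^ (n + 1) * hd

/-- Hensel lifting of fifth roots at `5`. -/
lemma exists_five_pow_dvd_fifth_pow_sub {a : ℤ} (ha : ¬ (5 : ℤ) ∣ a)
    (h : ∃ x : ℤ, (25 : ℤ) ∣ x ^ 5 - a) (k : ℕ) : ∃ x : ℤ, (5 : ℤ) ^ k ∣ x ^ 5 - a := by
  have hq : Prime (5 : ℤ) := by norm_num
  suffices H : ∀ n : ℕ, ∃ x : ℤ, (5 : ℤ) ^ (n + 2) ∣ x ^ 5 - a from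
    (H k).imp fun x hx => (pow_dvd_pow 5 (by lia)).trans hx
  intro n
  induction n with
  | zero => simpa using h
  | succ n ih =>
    obtain ⟨x, hx⟩ := ih
    have hqx := not_dvd_of_dvd_pow_sub ha (by norm_num) (by lia) hx
    obtain ⟨c, hc⟩ := hx
    have hu : ¬ (5 : ℤ) ∣ x ^ 4 := fun hxd => hqx (hq.dvd_of_dvd_pow hxd)
    obtain ⟨t, d, hd⟩ := exists_prime_dvd_add_mul hq hu c
    refine ⟨x + 5 ^ (n + 1) * t, d + 5 ^ n * (2 * x ^ 3 * t ^ 2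
      + 2 * x ^ 2 * t ^ 3 * 5 ^ (n + 1) + x * t ^ 4 * 5 ^ (2 * (n + 1))
      + t ^ 5 * 5 ^ (3 * n + 2)), ?_⟩
    linear_combination hc + 5 ^ (n + 2) * hd

/-- Two elements of a cyclic group have a fifth power among these six products. -/
lemma IsCyclic.exists_fifth_pow_eq {G : Type*} [CommGroup G] [IsCyclic G] (a b : G) :
    ∃ y : G, y ^ 5 = a ∨ y ^ 5 = b ∨ y ^ 5 = a * b ∨ y ^ 5 = a ^ 2 * b ∨ y ^ 5 = a * b ^ 2 ∨
      y ^ 5 = a ^ 4 * b := by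
  obtain ⟨g, hg⟩ := IsCyclic.exists_generator (α := G)
  obtain ⟨i, rfl⟩ := Subgroup.mem_zpowers_iff.1 (hg a)
  obtain ⟨j, rfl⟩ := Subgroup.mem_zpowers_iff.1 (hg b)
  have key : ∃ l : ℤ, l * 5 = i ∨ l * 5 = j ∨ l * 5 = i + j ∨ l * 5 = i * 2 + j ∨
      l * 5 = i + j * 2 ∨ l * 5 = i * 4 + j := by
    have : (5 : ℤ) ∣ i ∨ (5 : ℤ) ∣ j ∨ (5 : ℤ) ∣ i + j ∨ (5 : ℤ) ∣ i * 2 + j ∨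
      (5 : ℤ) ∣ i + j * 2 ∨ (5 : ℤ) ∣ i * 4 + j := by lia
    rcases this with ⟨l, hl⟩ | ⟨l, hl⟩ | ⟨l, hl⟩ | ⟨l, hl⟩ | ⟨l, hl⟩ | ⟨l, hl⟩ <;>
      exact ⟨l, by lia⟩
  obtain ⟨l, hl⟩ := key
  have e (m : ℤ) (n : ℕ) : (g ^ m) ^ n = g ^ (m * n) := by rw [zpow_mul, zpow_natCast]
  refine ⟨g ^ l, ?_⟩
  simp only [e, ← zpow_add]
  push_cast
  rcases hl with h | h | h | h | h | h <;> simp [h]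

/-- The integer version of `IsCyclic.exists_fifth_pow_eq` modulo a prime. -/
lemma exists_prime_dvd_fifth_pow_sub {q : ℕ} (hq : q.Prime) {a b : ℤ} (ha : ¬ (q : ℤ) ∣ a)
    (hb : ¬ (q : ℤ) ∣ b) :
    ∃ c ∈ ({a, b, a * b, a ^ 2 * b, a * b ^ 2, a ^ 4 * b} : Set ℤ),
      ∃ x : ℤ, (q : ℤ) ∣ x ^ 5 - c := by
  have := Fact.mk hq
  rw [← ZMod.intCast_zmod_eq_zero_iff_dvd] at ha hb
  obtain ⟨y, hy⟩ := IsCyclic.exists_fifth_pow_eq (Units.mk0 _ ha) (Units.mk0 _ hb)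
  obtain ⟨x, hx⟩ := ZMod.intCast_surjective (y : ZMod q)
  have e (c : ℤ) : (q : ℤ) ∣ x ^ 5 - c ↔ (y : ZMod q) ^ 5 = c := by
    rw [← ZMod.intCast_zmod_eq_zero_iff_dvd, Int.cast_sub, Int.cast_pow, hx, sub_eq_zero]
  simp only [Units.ext_iff, Units.val_mul, Units.val_pow_eq_pow_val, Units.val_mk0] at hy
  rcases hy with h | h | h | h | h | h
  · exact ⟨a, by simp, x, (e _).2 h⟩
  · exact ⟨b, by simp, x, (e _).2 h⟩
  · exact ⟨a * b, by simp, x, (e _).2 (by push_cast; exact h)⟩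
  · exact ⟨a ^ 2 * b, by simp, x, (e _).2 (by push_cast; exact h)⟩
  · exact ⟨a * b ^ 2, by simp, x, (e _).2 (by push_cast; exact h)⟩
  · exact ⟨a ^ 4 * b, by simp, x, (e _).2 (by push_cast; exact h)⟩

/-- An integer polynomial with roots modulo all prime powers has roots modulo all positive
integers. -/
lemma Polynomial.exists_dvd_eval_of_prime_pow (f : Polynomial ℤ)
    (h : ∀ q k : ℕ, q.Prime → ∃ x : ℤ, (q : ℤ) ^ k ∣ f.eval x) (m : ℕ) (hm : 0 < m) :
    ∃ x : ℤ, (m : ℤ) ∣ f.eval x := by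
  induction m using Nat.recOnPosPrimePosCoprime with
  | prime_pow q k hq _ => simpa using h q k hq
  | zero => exact absurd hm (lt_irrefl 0)
  | one => exact ⟨0, by simp⟩
  | coprime a b ha hb hab iha ihb =>
    obtain ⟨x, hx⟩ := iha (by lia)
    obtain ⟨y, hy⟩ := ihb (by lia)
    have hc : IsCoprime (a : ℤ) b := hab.isCoprime
    obtain ⟨r, s, hrs⟩ := id hc
    refine ⟨x * (s * b) + y * (r * a), ?_⟩
    rw [Nat.cast_mul]
    refine hc.mul_dvd ?_ ?_
    · refine (dvd_iff_dvd_of_dvd_sub (dvd_trans ?_ (sub_dvd_eval_sub _ x f))).2 hx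
      exact ⟨r * (y - x), by linear_combination x * hrs⟩
    · refine (dvd_iff_dvd_of_dvd_sub (dvd_trans ?_ (sub_dvd_eval_sub _ y f))).2 hy
      exact ⟨s * (x - y), by linear_combination y * hrs⟩

/-- If the 25th power of a prime divides a product of six integers, then its fifth power divides
one of them. -/
lemma Prime.pow_five_dvd_of_dvd_mul {q : ℤ} (hq : Prime q) {a b c d e f : ℤ}
    (h : q ^ 25 ∣ a * b * c * d * e * f) :
    q ^ 5 ∣ a ∨ q ^ 5 ∣ b ∨ q ^ 5 ∣ c ∨ q ^ 5 ∣ d ∨ q ^ 5 ∣ e ∨ q ^ 5 ∣ f := by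
  have split {k : ℕ} {u v : ℤ} (h : q ^ (k + 5) ∣ u * v) : q ^ (k + 1) ∣ u ∨ q ^ 5 ∣ v := by
    by_contra! ⟨hu, hv⟩
    rw [← emultiplicity_lt_iff_not_dvd] at hu hv
    rw [pow_dvd_iff_le_emultiplicity, emultiplicity_mul hq] at h
    lift emultiplicity q u to ℕ using hu.ne_top with m
    lift emultiplicity q v to ℕ using hv.ne_top with n
    norm_cast at hu hv h
    lia
  rcases split (k := 20) h with h | h
  · rcases split (k := 16) h with h | h
    · rcases split (k := 12) h with h | h
      · rcases split (k := 8) h with h | h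
        · rcases split (k := 4) h with h | h <;> tauto
        · tauto
      · tauto
    · tauto
  · tauto

/-- A number of valuation prime to five is not a fifth power locally. -/
lemma not_pow_five_dvd_fifth_pow_sub {q : ℤ} (hq : Prime q) {c : ℤ} (hc : ¬ q ∣ c) {j : ℕ}
    (hj : j ≠ 0) (hj5 : j < 5) (x : ℤ) : ¬ q ^ 5 ∣ x ^ 5 - c * q ^ j := by
  intro h
  have hx : q ∣ x := hq.dvd_of_dvd_pow ((dvd_sub_left ((dvd_pow_self q hj).mul_left c)).1
    ((dvd_pow_self q (by norm_num)).trans h))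
  have hxd := (pow_dvd_pow q hj5).trans ((dvd_sub_right (pow_dvd_pow_of_dvd hx 5)).1 h)
  rw [pow_succ', mul_dvd_mul_iff_right (pow_ne_zero j hq.ne_zero)] at hxd
  exact hc hxd

/-- Criterion for `(x⁵-p₁)(x⁵-p₂)(x⁵-p₁p₂)(x⁵-p₁²p₂)(x⁵-p₁p₂²)(x⁵-p₁⁴p₂)`
to have roots modulo every positive integer. -/
theorem stmt8 (p₁ p₂ : ℕ) (hp₁ : p₁.Prime) (hp₂ : p₂.Prime)
    (hne : p₁ ≠ p₂) (h5₁ : p₁ ≠ 5) (h5₂ : p₂ ≠ 5) :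
    (∀ m : ℕ, 0 < m → ∃ x : ℤ,
      (m : ℤ) ∣ (x ^ 5 - p₁) * (x ^ 5 - p₂) * (x ^ 5 - p₁ * p₂) *
        (x ^ 5 - p₁ ^ 2 * p₂) * (x ^ 5 - p₁ * p₂ ^ 2) * (x ^ 5 - p₁ ^ 4 * p₂)) ↔
    ((∃ a ∈ ({(p₁ : ℤ), (p₂ : ℤ), (p₁ : ℤ) * p₂, (p₁ : ℤ) ^ 2 * p₂,
          (p₁ : ℤ) * (p₂ : ℤ) ^ 2, (p₁ : ℤ) ^ 4 * p₂} : Set ℤ),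
        ∃ x : ℤ, (3125 : ℤ) ∣ x ^ 5 - a) ∧
     ((∃ x : ℤ, (p₂ : ℤ) ∣ x ^ 5 - p₁) ∧ (∃ x : ℤ, (p₁ : ℤ) ∣ x ^ 5 - p₂))) := by
  have hq₁ : Prime (p₁ : ℤ) := Nat.prime_iff_prime_int.1 hp₁
  have hq₂ : Prime (p₂ : ℤ) := Nat.prime_iff_prime_int.1 hp₂
  have hndvd {q p : ℕ} (hq : q.Prime) (hp : p.Prime) (hqp : q ≠ p) : ¬ (q : ℤ) ∣ p := by
    rwa [Int.natCast_dvd_natCast, Nat.prime_dvd_prime_iff_eq hq hp]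
  have h₁₂ := hndvd hp₁ hp₂ hne
  have h₂₁ := hndvd hp₂ hp₁ hne.symm
  constructor
  · intro H
    have hH {q : ℕ} (hq : q.Prime) := H (q ^ 25) (pow_pos hq.pos 25)
    simp only [Nat.cast_pow] at hH
    refine ⟨?_, ?_, ?_⟩
    · obtain ⟨x, hx⟩ := hH Nat.prime_five
      rcases (Nat.prime_iff_prime_int.1 Nat.prime_five).pow_five_dvd_of_dvd_mul hx with
        h | h | h | h | h | h <;> norm_num at h <;> exact ⟨_, by simp, x, h⟩
    · obtain ⟨x, hx⟩ := hH hp₂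
      have hno {c : ℤ} (hc : ¬ (p₂ : ℤ) ∣ c) {j : ℕ} (hj : j ≠ 0) (hj5 : j < 5) :=
        not_pow_five_dvd_fifth_pow_sub hq₂ hc hj hj5 x
      have hn (n : ℕ) : ¬ (p₂ : ℤ) ∣ (p₁ : ℤ) ^ n := fun h => h₂₁ (hq₂.dvd_of_dvd_pow h)
      rcases hq₂.pow_five_dvd_of_dvd_mul hx with h | h | h | h | h | h
      · exact ⟨x, (dvd_pow_self _ (by norm_num)).trans h⟩
      · exact absurd (by simpa using h) (hno (hn 0) one_ne_zero (by norm_num))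
      · exact absurd (by simpa using h) (hno (hn 1) one_ne_zero (by norm_num))
      · exact absurd (by simpa using h) (hno (hn 2) one_ne_zero (by norm_num))
      · exact absurd (by simpa using h) (hno (hn 1) two_ne_zero (by norm_num))
      · exact absurd (by simpa using h) (hno (hn 4) one_ne_zero (by norm_num))
    · obtain ⟨x, hx⟩ := hH hp₁
      have hno {c : ℤ} (hc : ¬ (p₁ : ℤ) ∣ c) {j : ℕ} (hj : j ≠ 0) (hj5 : j < 5) :=
        not_pow_five_dvd_fifth_pow_sub hq₁ hc hj hj5 x
      have hn (n : ℕ) : ¬ (p₁ : ℤ) ∣ (p₂ : ℤ) ^ n := fun h => h₁₂ (hq₁.dvd_of_dvd_pow h)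
      rcases hq₁.pow_five_dvd_of_dvd_mul hx with h | h | h | h | h | h
      · exact absurd (by simpa using h) (hno (hn 0) one_ne_zero (by norm_num))
      · exact ⟨x, (dvd_pow_self _ (by norm_num)).trans h⟩
      · exact absurd (by simpa [mul_comm] using h) (hno (hn 1) one_ne_zero (by norm_num))
      · exact absurd (by simpa [mul_comm] using h) (hno (hn 1) two_ne_zero (by norm_num))
      · exact absurd (by simpa [mul_comm] using h) (hno (hn 2) one_ne_zero (by norm_num))
      · exact absurd (by simpa [mul_comm] using h) (hno (hn 1) four_ne_zero (by norm_num))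
  · rintro ⟨⟨a, ha, h5⟩, h2, h1⟩
    suffices H : ∀ q k : ℕ, q.Prime → ∃ a ∈ ({(p₁ : ℤ), (p₂ : ℤ), (p₁ : ℤ) * p₂,
        (p₁ : ℤ) ^ 2 * p₂, (p₁ : ℤ) * (p₂ : ℤ) ^ 2, (p₁ : ℤ) ^ 4 * p₂} : Set ℤ),
        ∃ x : ℤ, (q : ℤ) ^ k ∣ x ^ 5 - a by
      intro m hm
      have := Polynomial.exists_dvd_eval_of_prime_pow
        ((.X ^ 5 - .C (p₁ : ℤ)) * (.X ^ 5 - .C (p₂ : ℤ)) * (.X ^ 5 - .C ((p₁ : ℤ) * p₂)) *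
          (.X ^ 5 - .C ((p₁ : ℤ) ^ 2 * p₂)) * (.X ^ 5 - .C ((p₁ : ℤ) * (p₂ : ℤ) ^ 2)) *
          (.X ^ 5 - .C ((p₁ : ℤ) ^ 4 * p₂))) ?_ m hm
      · simpa only [Polynomial.eval_mul, Polynomial.eval_sub, Polynomial.eval_pow,
          Polynomial.eval_X, Polynomial.eval_C] using this
      · intro q k hq
        obtain ⟨a, ha, x, hx⟩ := H q k hq
        refine ⟨x, hx.trans ?_⟩
        simp only [Polynomial.eval_mul, Polynomial.eval_sub, Polynomial.eval_pow,
          Polynomial.eval_X, Polynomial.eval_C]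
        simp only [Set.mem_insert_iff, Set.mem_singleton_iff] at ha
        rcases ha with rfl | rfl | rfl | rfl | rfl | rfl
        · simp only [mul_assoc, dvd_mul_right]
        · exact ((((dvd_mul_left _ _).mul_right _).mul_right _).mul_right _).mul_right _
        · exact (((dvd_mul_left _ _).mul_right _).mul_right _).mul_right _
        · exact ((dvd_mul_left _ _).mul_right _).mul_right _
        · exact (dvd_mul_left _ _).mul_right _
        · exact dvd_mul_left _ _
    intro q k hq
    have hqi : Prime (q : ℤ) := Nat.prime_iff_prime_int.1 hq
    have hunit (hn₁ : q ≠ p₁) (hn₂ : q ≠ p₂) {a : ℤ} (ha : a ∈ ({(p₁ : ℤ), (p₂ : ℤ),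
        (p₁ : ℤ) * p₂, (p₁ : ℤ) ^ 2 * p₂, (p₁ : ℤ) * (p₂ : ℤ) ^ 2, (p₁ : ℤ) ^ 4 * p₂} : Set ℤ)) :
        ¬ (q : ℤ) ∣ a := by
      have e₁ := hndvd hq hp₁ hn₁
      have e₂ := hndvd hq hp₂ hn₂
      simp only [Set.mem_insert_iff, Set.mem_singleton_iff] at ha
      rcases ha with rfl | rfl | rfl | rfl | rfl | rfl <;>
        simp [hqi.dvd_mul, hqi.dvd_pow_iff_dvd, e₁, e₂]
    have hfive (hq5 : q ≠ 5) : ¬ (q : ℤ) ∣ 5 := mod_cast hndvd hq Nat.prime_five hq5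
    by_cases hq5 : q = 5
    · subst hq5
      refine ⟨a, ha, ?_⟩
      exact exists_five_pow_dvd_fifth_pow_sub (hunit h5₁.symm h5₂.symm ha)
        (h5.imp fun x hx => dvd_trans (by norm_num) hx) k
    by_cases hqp₁ : q = p₁
    · subst hqp₁
      exact ⟨p₂, by simp, exists_prime_pow_dvd_fifth_pow_sub hqi (hfive hq5) h₁₂ h1 k⟩
    by_cases hqp₂ : q = p₂
    · subst hqp₂
      exact ⟨p₁, by simp, exists_prime_pow_dvd_fifth_pow_sub hqi (hfive hq5) h₂₁ h2 k⟩
    obtain ⟨c, hc, h⟩ := exists_prime_dvd_fifth_pow_sub hq (hndvd hq hp₁ hqp₁) (hndvd hq hp₂ hqp₂)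
    exact ⟨c, hc, exists_prime_pow_dvd_fifth_pow_sub hqi (hfive hq5) (hunit hqp₁ hqp₂ hc) h k⟩
end

section
/- Let q be an odd prime and let p_1 be a prime. Then the polynomial (x^q − p_1)(x^q − p_1^2)⋯(x^q − p_1^{q−1}) does not have a root modulo every positive integer; that is, there exists a positive integer m such that the congruence ∏_{i=1}^{q−1}(x^q − p_1^i) ≡ 0 (mod m) has no integer solution. -/
/-- A `q`-th power cannot be congruent to `p ^ i` modulo `p ^ (i + 1)` unless `q ∣ i`. -/
theorem emultiplicity_pow_sub_prime_pow_le {p : ℤ} (hp : Prime p) {q i : ℕ} (hqi : ¬ q ∣ i)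
    (x : ℤ) : emultiplicity p (x ^ q - p ^ i) ≤ i := by
  by_contra! h
  have hdvd : p ^ (i + 1) ∣ x ^ q - p ^ i :=
    pow_dvd_of_le_emultiplicity (by exact_mod_cast Order.add_one_le_of_lt h)
  have hpow : emultiplicity p (x ^ q) = i := by
    rw [emultiplicity_eq_coe]
    refine ⟨(dvd_sub_left dvd_rfl).mp ((pow_dvd_pow p i.le_succ).trans hdvd), fun hx ↦ ?_⟩
    have hself : p ^ (i + 1) ∣ p ^ i := (dvd_sub_right hx).mp hdvd
    have := (pow_dvd_pow_iff hp.ne_zero hp.not_isUnit).mp hself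
    omega
  rw [emultiplicity_pow hp] at hpow
  have hq : q ≠ 0 := by
    rintro rfl
    apply hqi
    have : (0 : ℕ∞) = i := by simpa using hpow
    rw [← Nat.cast_zero, Nat.cast_inj] at this
    exact this ▸ dvd_rfl
  have hfin : emultiplicity p x ≠ ⊤ := by
    intro htop
    rw [htop, ENat.mul_top (by exact_mod_cast hq)] at hpow
    exact ENat.top_ne_natCast _ hpow
  obtain ⟨k, hk⟩ := ENat.ne_top_iff_exists.mp hfin
  rw [← hk] at hpow
  exact hqi ⟨k, by exact_mod_cast hpow.symm⟩

/-- The polynomial `∏_{i=1}^{q-1} (x^q - p₁^i)` fails to have a root modulo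
some positive integer. -/
theorem stmt9 (q : ℕ) (hq : q.Prime) (hq_odd : Odd q)
    (p₁ : ℕ) (hp₁ : p₁.Prime) :
    ∃ m : ℕ, 0 < m ∧ ∀ x : ℤ,
      ¬ ((m : ℤ) ∣ ∏ i ∈ Finset.Icc 1 (q - 1), (x ^ q - (p₁ : ℤ) ^ i)) := by
  have hp : Prime (p₁ : ℤ) := Nat.prime_iff_prime_int.mp hp₁
  refine ⟨p₁ ^ (∑ i ∈ Finset.Icc 1 (q - 1), i + 1), pow_pos hp₁.pos _, fun x ↦ ?_⟩
  rw [Nat.cast_pow, ← emultiplicity_lt_iff_not_dvd, Finset.emultiplicity_prod hp]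
  refine lt_of_le_of_lt (b := ((∑ i ∈ Finset.Icc 1 (q - 1), i : ℕ) : ℕ∞)) ?_
    (by exact_mod_cast Nat.lt_succ_self _)
  rw [Nat.cast_sum]
  refine Finset.sum_le_sum fun i hi ↦ emultiplicity_pow_sub_prime_pow_le hp ?_ x
  rw [Finset.mem_Icc] at hi
  exact Nat.not_dvd_of_pos_of_lt hi.1 (by omega)
end

section
/- Let q be an odd prime and let a be an integer that is not a perfect q-th power. Then there exist infinitely many primes p not dividing a such that a is not a q-th power modulo p. -/
open Filter Topology NumberField Polynomial ArithmeticFunction.vonMangoldt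

theorem RingOfIntegers.exponent_ne_zero_of_adjoin_eq_top {K : Type*} [Field K] [NumberField K]
    {θ : 𝓞 K} (hθ : Algebra.adjoin ℚ {(θ : K)} = ⊤) : RingOfIntegers.exponent θ ≠ 0 := by
  have hc : conductor ℤ θ ≠ ⊥ := by
    intro h
    have key := conductor_mul_differentIdeal ℤ ℚ K θ hθ
    rw [h, Ideal.bot_mul, eq_comm, Ideal.span_singleton_eq_bot] at key
    have hmin := minpoly.isIntegrallyClosed_eq_field_fractions ℚ K θ.isIntegral
    have hsep : (minpoly ℚ (θ : K)).Separable := Algebra.IsSeparable.isSeparable ℚ (θ : K)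
    refine hsep.aeval_derivative_ne_zero (minpoly.aeval ℚ (θ : K)) ?_
    rw [hmin, derivative_map, aeval_map_algebraMap, aeval_algebraMap_apply, key, map_zero]
  rw [RingOfIntegers.exponent, Ne, Ideal.absNorm_eq_zero_iff]
  exact Ideal.under_ne_bot ℤ hc

/-- A root of the minimal polynomial modulo `p` gives a prime ideal of norm `p`. -/
theorem NumberField.exists_prime_ideal_of_dvd_eval_minpoly {K : Type*} [Field K] [NumberField K]
    {θ : 𝓞 K} {p : ℕ} (hp : p.Prime) (hpθ : ¬ p ∣ RingOfIntegers.exponent θ) {x : ℤ}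
    (hx : (p : ℤ) ∣ (minpoly ℤ θ).eval x) :
    ∃ P : Ideal (𝓞 K), P.IsPrime ∧ Ideal.absNorm P = p ∧ θ - (x : 𝓞 K) ∈ P := by
  have : Fact p.Prime := ⟨hp⟩
  have h0 : (minpoly ℤ θ).map (Int.castRingHom (ZMod p)) ≠ 0 :=
    map_monic_ne_zero (minpoly.monic θ.isIntegral)
  have hmap : (X - C x : ℤ[X]).map (Int.castRingHom (ZMod p)) = X - C (x : ZMod p) := by simp
  have hQ : (X - C x : ℤ[X]).map (Int.castRingHom (ZMod p)) ∈
      RingOfIntegers.monicFactorsMod θ p := by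
    rw [Multiset.mem_toFinset, Polynomial.mem_normalizedFactors_iff h0, hmap]
    refine ⟨irreducible_X_sub_C _, monic_X_sub_C _, ?_⟩
    rw [dvd_iff_isRoot, IsRoot, ← eq_intCast (Int.castRingHom (ZMod p)), eval_map_apply, eq_intCast]
    exact (ZMod.intCast_zmod_eq_zero_iff_dvd _ p).2 hx
  set P := (NumberField.Ideal.primesOverSpanEquivMonicFactorsMod hpθ).symm ⟨_, hQ⟩ with hP
  have hprime : (P : Ideal (𝓞 K)).IsPrime := P.2.1
  have hlies : (P : Ideal (𝓞 K)).LiesOver (Ideal.span {(p : ℤ)}) := P.2.2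
  refine ⟨P, hprime, ?_, ?_⟩
  · rw [← Ideal.natAbs_pow_inertiaDeg (p : ℤ) (P : Ideal (𝓞 K)), hP,
      NumberField.Ideal.inertiaDeg_primesOverSpanEquivMonicFactorsMod_symm_apply, hmap,
      natDegree_X_sub_C, pow_one, Int.natAbs_natCast]
  · rw [hP, NumberField.Ideal.primesOverSpanEquivMonicFactorsMod_symm_apply_eq_span]
    exact Ideal.subset_span (by simp)

theorem Ideal.prod_injOn_powerset_of_isPrime {R : Type*} [CommRing R] [IsDedekindDomain R]
    {S : Finset (Ideal R)} (hS : ∀ P ∈ S, P.IsPrime ∧ P ≠ ⊥) :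
    Set.InjOn (fun T : Finset (Ideal R) ↦ ∏ P ∈ T, P) S.powerset := by
  have hmem {T : Finset (Ideal R)} (hT : T ⊆ S) {P : Ideal R} (hP : P ∈ S) :
      P ∣ ∏ Q ∈ T, Q ↔ P ∈ T := by
    refine ⟨fun h ↦ ?_, fun h ↦ Finset.dvd_prod_of_mem _ h⟩
    have hprime := Ideal.prime_of_isPrime (hS P hP).2 (hS P hP).1
    obtain ⟨Q, hQ, hPQ⟩ := (hprime.dvd_finsetProd_iff _).1 h
    have hQprime := Ideal.prime_of_isPrime (hS Q (hT hQ)).2 (hS Q (hT hQ)).1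
    rwa [associated_iff_eq.1 (hprime.associated_of_dvd hQprime hPQ)]
  intro T hT T' hT' h
  rw [Finset.mem_coe, Finset.mem_powerset] at hT hT'
  ext P
  by_cases hP : P ∈ S
  · rw [← hmem hT hP, ← hmem hT' hP]
    exact iff_of_eq (congrArg (P ∣ ·) h)
  · exact iff_of_false (fun h ↦ hP (hT h)) (fun h ↦ hP (hT' h))

theorem NumberField.prod_one_add_absNorm_rpow_le {K : Type*} [Field K] [NumberField K]
    {S : Finset (Ideal (𝓞 K))} (hS : ∀ P ∈ S, P.IsPrime ∧ P ≠ ⊥) {s : ℝ}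
    (hs : dedekindZeta K s ≠ 0) :
    ∏ P ∈ S, (1 + (Ideal.absNorm P : ℝ) ^ (-s)) ≤ (dedekindZeta K s).re := by
  classical
  set r : ℕ → ℕ := fun n ↦ Nat.card {I : Ideal (𝓞 K) // Ideal.absNorm I = n} with hr
  have hsum : LSeriesSummable (fun n ↦ (r n : ℂ)) s := by
    by_contra h
    exact hs (tsum_eq_zero_of_not_summable h)
  have hterm (n : ℕ) : (LSeries.term (fun n ↦ (r n : ℂ)) s n).re =
      if n = 0 then 0 else r n * (n : ℝ) ^ (-s) := by
    rcases eq_or_ne n 0 with rfl | hn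
    · simp
    · rw [LSeries.term_of_ne_zero hn, if_neg hn, div_eq_mul_inv, ← Complex.ofReal_natCast n,
        ← Complex.ofReal_cpow n.cast_nonneg, ← Complex.ofReal_natCast, ← Complex.ofReal_inv,
        ← Complex.ofReal_mul, Complex.ofReal_re, Real.rpow_neg n.cast_nonneg]
  have hzeta : (dedekindZeta K s).re = ∑' n, if n = 0 then 0 else r n * (n : ℝ) ^ (-s) := by
    rw [dedekindZeta, LSeries, Complex.re_tsum hsum]
    exact tsum_congr hterm
  have hsum' : Summable fun n : ℕ ↦ if n = 0 then 0 else r n * (n : ℝ) ^ (-s) :=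
    (Complex.reCLM.summable hsum).congr hterm
  have hprod (T : Finset (Ideal (𝓞 K))) : ∏ P ∈ T, (Ideal.absNorm P : ℝ) ^ (-s) =
      (Ideal.absNorm (∏ P ∈ T, P) : ℝ) ^ (-s) := by
    rw [Real.finsetProd_rpow _ _ fun _ _ ↦ Nat.cast_nonneg _, map_prod, Nat.cast_prod]
  rw [hzeta, Finset.prod_one_add, Finset.sum_congr rfl fun T _ ↦ hprod T,
    Finset.sum_comp (fun n : ℕ ↦ (n : ℝ) ^ (-s)) fun T ↦ Ideal.absNorm (∏ P ∈ T, P)]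
  refine (Finset.sum_le_sum fun n hn ↦ ?_).trans
    (hsum'.sum_le_tsum _ fun n _ ↦ by split_ifs <;> positivity)
  obtain ⟨T, hT, rfl⟩ := Finset.mem_image.1 hn
  have hT0 : Ideal.absNorm (∏ P ∈ T, P) ≠ 0 := by
    rw [Ne, Ideal.absNorm_eq_zero_iff]
    exact Finset.prod_ne_zero_iff.2 fun P hP ↦ (hS P (Finset.mem_powerset.1 hT hP)).2
  rw [if_neg hT0, nsmul_eq_mul]
  gcongr
  set m := Ideal.absNorm (∏ P ∈ T, P)
  have : Finite {I : Ideal (𝓞 K) // Ideal.absNorm I = m} :=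
    Ideal.finite_setOfPred_absNorm_eq m
  rw [← Nat.card_eq_finsetCard]
  refine Nat.card_le_card_of_injective
    (fun T' ↦ ⟨∏ P ∈ T'.1, P, (Finset.mem_filter.1 T'.2).2⟩) fun T₁ T₂ h ↦ Subtype.ext ?_
  exact Ideal.prod_injOn_powerset_of_isPrime hS (Finset.mem_filter.1 T₁.2).1
    (Finset.mem_filter.1 T₂.2).1 (congrArg Subtype.val h)

/-- The sum of the reciprocals of the primes in an invertible residue class diverges. -/
theorem not_summable_indicator_prime_residueClass_inv {q : ℕ} [NeZero q] {a : ZMod q}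
    (ha : IsUnit a) :
    ¬ Summable ({p : ℕ | p.Prime ∧ (p : ZMod q) = a}.indicator fun n ↦ (n : ℝ)⁻¹) := by
  intro hsum
  set f := {p : ℕ | p.Prime ∧ (p : ZMod q) = a}.indicator fun n ↦ (n : ℝ)⁻¹ with hf
  have hf0 (n : ℕ) : 0 ≤ f n := Set.indicator_nonneg (fun _ _ ↦ by positivity) n
  have hnp := summable_residueClass_non_primes_div a
  set g : ℕ → ℝ := fun n ↦ (if n.Prime then 0 else residueClass a n) / n with hg
  have hg0 (n : ℕ) : 0 ≤ g n := by
    have := residueClass_nonneg a n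
    simp only [hg]
    split_ifs <;> positivity
  obtain ⟨C, hC⟩ := LSeries_residueClass_lower_bound ha
  have hbound {ε : ℝ} (hε : 0 < ε) (n : ℕ) :
      ‖ε * (Real.log n / (n : ℝ) ^ ε) * f n‖ ≤ f n := by
    rcases n.eq_zero_or_pos with rfl | hn
    · simpa using hf0 0
    · have hpos : 0 < (n : ℝ) ^ ε := by positivity
      have hlog : 0 ≤ Real.log n := Real.log_natCast_nonneg n
      rw [Real.norm_of_nonneg (mul_nonneg (by positivity) (hf0 n))]
      refine mul_le_of_le_one_left (hf0 n) ?_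
      rw [← mul_div_assoc, div_le_one hpos, mul_comm, ← le_div_iff₀ hε]
      exact Real.log_le_rpow_div n.cast_nonneg hε
  have hlim : Tendsto (fun ε : ℝ ↦ ∑' n : ℕ, ε * (Real.log n / (n : ℝ) ^ ε) * f n) (𝓝[>] 0)
      (𝓝 (∑' _ : ℕ, (0 : ℝ))) := by
    refine tendsto_tsum_of_dominated_convergence hsum (fun n ↦ ?_) ?_
    · refine tendsto_nhdsWithin_of_tendsto_nhds ?_
      rcases n.eq_zero_or_pos with rfl | hn
      · simp [hf]
      · have hn' : (n : ℝ) ≠ 0 := by positivity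
        have : ContinuousAt (fun ε : ℝ ↦ ε * (Real.log n / (n : ℝ) ^ ε) * f n) 0 := by
          have h1 : ContinuousAt (fun ε : ℝ ↦ (n : ℝ) ^ ε) 0 := Real.continuousAt_const_rpow hn'
          exact (continuousAt_id.mul (continuousAt_const.div h1 (by simp))).mul continuousAt_const
        simpa [ContinuousAt] using this
    · filter_upwards [self_mem_nhdsWithin] with ε hε n using hbound hε n
  rw [tsum_zero] at hlim
  have hineq : ∀ᶠ ε : ℝ in 𝓝[>] 0, (q.totient : ℝ)⁻¹ - ε * (C + ∑' n, g n) ≤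
      ∑' n : ℕ, ε * (Real.log n / (n : ℝ) ^ ε) * f n := by
    filter_upwards [Ioc_mem_nhdsGT one_pos] with ε hε
    have hs : Summable fun n : ℕ ↦ ε * (Real.log n / (n : ℝ) ^ ε) * f n :=
      hsum.of_norm_bounded (hbound hε.1)
    have key := hC (x := 1 + ε) ⟨by linarith [hε.1], by linarith [hε.2]⟩
    rw [add_sub_cancel_left] at key
    have hle (n : ℕ) : ε * (residueClass a n / (n : ℝ) ^ (1 + ε)) ≤
        ε * g n + ε * (Real.log n / (n : ℝ) ^ ε) * f n := by
      rcases n.eq_zero_or_pos with rfl | hn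
      · simp [hg, hf]
      have hn' : (0 : ℝ) < n := by positivity
      rw [mul_assoc, ← mul_add]
      refine mul_le_mul_of_nonneg_left ?_ hε.1.le
      rw [Real.rpow_add hn', Real.rpow_one]
      have h1 : 1 ≤ (n : ℝ) ^ ε := Real.one_le_rpow (by exact_mod_cast hn) hε.1.le
      by_cases hp : n.Prime
      · have hgn : g n = 0 := by simp [hg, hp]
        rw [hgn, zero_add]
        simp only [hf, Set.indicator, Set.mem_ofPred_eq, hp, true_and]
        split_ifs
        · rw [ArithmeticFunction.vonMangoldt_apply_prime hp, ← div_eq_mul_inv, div_div, mul_comm]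
        · simp
      · have : f n = 0 := Set.indicator_of_notMem (fun h ↦ hp h.1) _
        rw [this, mul_zero, add_zero]
        simp only [hg, if_neg hp]
        exact div_le_div_of_nonneg_left (residueClass_nonneg a n) hn'
          (le_mul_of_one_le_right hn'.le h1)
    have hsum2 := (hnp.mul_left ε).add hs
    have := (hsum2.of_nonneg_of_le (fun n ↦ mul_nonneg hε.1.le
      (div_nonneg (residueClass_nonneg a n) (by positivity))) hle).tsum_le_tsum hle hsum2
    rw [(hnp.mul_left ε).tsum_add hs, tsum_mul_left, tsum_mul_left] at this
    have key' := mul_le_mul_of_nonneg_left key hε.1.le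
    rw [mul_sub, mul_div_cancel₀ _ hε.1.ne'] at key'
    linarith
  have hlim' : Tendsto (fun ε : ℝ ↦ (q.totient : ℝ)⁻¹ - ε * (C + ∑' n, g n)) (𝓝[>] 0)
      (𝓝 ((q.totient : ℝ)⁻¹)) := by
    refine tendsto_nhdsWithin_of_tendsto_nhds ?_
    have : ContinuousAt (fun ε : ℝ ↦ (q.totient : ℝ)⁻¹ - ε * (C + ∑' n, g n)) 0 := by fun_prop
    simpa [ContinuousAt] using this
  have hpos : 0 < (q.totient : ℝ)⁻¹ := inv_pos.2 (mod_cast Nat.totient_pos.2 (NeZero.pos q))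
  exact absurd (le_of_tendsto_of_tendsto hlim' hlim hineq) hpos.not_ge

theorem Real.tendsto_prod_primesBelow_one_sub_rpow {s : ℝ} (hs : 1 < s) :
    Tendsto (fun N : ℕ ↦ ∏ p ∈ N.primesBelow, (1 - (p : ℝ) ^ (-s))⁻¹) atTop
      (𝓝 (∑' n : ℕ, 1 / (n : ℝ) ^ s)) := by
  let f : ℕ →*₀ ℝ :=
    { toFun n := (n : ℝ) ^ (-s)
      map_zero' := by simp [Real.zero_rpow (by linarith : -s ≠ 0)]
      map_one' := by simp
      map_mul' m n := by simp [Real.mul_rpow] }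
  have hf (n : ℕ) : f n = 1 / (n : ℝ) ^ s := by
    rw [one_div, ← Real.rpow_neg n.cast_nonneg]
    rfl
  have hsum : Summable (‖f ·‖) := by
    refine (Real.summable_one_div_nat_rpow.2 hs).congr fun n ↦ ?_
    rw [hf, Real.norm_of_nonneg (by positivity)]
  simp only [← hf]
  exact EulerProduct.eulerProduct_completely_multiplicative hsum

theorem exists_forall_prod_primesBelow_one_sub_rpow_le :
    ∃ D : ℝ, ∀ s : ℝ, 1 < s → ∀ N : ℕ, ∏ p ∈ N.primesBelow, (1 - (p : ℝ) ^ (-s))⁻¹ ≤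
      D * ∏ p ∈ N.primesBelow, (1 + (p : ℝ) ^ (-s)) := by
  obtain ⟨D, hD⟩ := (Real.tendsto_prod_primesBelow_one_sub_rpow one_lt_two).bddAbove_range
  refine ⟨D, fun s hs N ↦ ?_⟩
  refine le_trans ?_ (mul_le_mul_of_nonneg_right (hD ⟨N, rfl⟩) <|
    Finset.prod_nonneg fun p _ ↦ by positivity)
  simp only [← Finset.prod_mul_distrib]
  have hlt {p : ℕ} (hp : p ∈ N.primesBelow) {t : ℝ} (ht : 0 < t) : (p : ℝ) ^ (-t) < 1 :=
    Real.rpow_lt_one_of_one_lt_of_neg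
      (mod_cast (Nat.prime_of_mem_primesBelow hp).one_lt) (by linarith)
  refine Finset.prod_le_prod (fun p hp ↦ ?_) fun p hp ↦ ?_
  · exact inv_nonneg.2 (sub_nonneg.2 (hlt hp (by linarith)).le)
  have hx := hlt hp (by linarith : 0 < s)
  have hy := hlt hp two_pos
  have hx0 : (0 : ℝ) ≤ (p : ℝ) ^ (-s) := by positivity
  have hp1 : (1 : ℝ) ≤ p := mod_cast (Nat.prime_of_mem_primesBelow hp).one_lt.le
  have hxy : ((p : ℝ) ^ (-s)) ^ 2 ≤ (p : ℝ) ^ (-(2 : ℝ)) := by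
    rw [← Real.rpow_natCast, ← Real.rpow_mul (by positivity)]
    exact Real.rpow_le_rpow_of_exponent_le hp1 (by push_cast; linarith)
  generalize (p : ℝ) ^ (-s) = x at *
  rw [← div_eq_inv_mul, inv_eq_one_div, div_le_div_iff₀ (by linarith) (by linarith)]
  nlinarith

theorem Finset.sum_le_prod_one_add {ι : Type*} (s : Finset ι) {f : ι → ℝ} (hf : ∀ i, 0 ≤ f i) :
    ∑ i ∈ s, f i ≤ ∏ i ∈ s, (1 + f i) := by
  classical
  suffices h : 1 + ∑ i ∈ s, f i ≤ ∏ i ∈ s, (1 + f i) by linarith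
  induction s using Finset.induction_on with
  | empty => simp
  | insert i s hi ih =>
    rw [sum_insert hi, prod_insert hi]
    have := Finset.sum_nonneg fun i (_ : i ∈ s) ↦ hf i
    nlinarith [hf i]

theorem NumberField.prod_primesBelow_mul_sum_rpow_le {K : Type*} [Field K]
    [NumberField K] {E F : Finset ℕ} {P Q : ℕ → Ideal (𝓞 K)}
    (hP : ∀ p, p.Prime → p ∉ E → (P p).IsPrime ∧ Ideal.absNorm (P p) = p)
    (hF : ∀ p ∈ F, p.Prime ∧ p ∉ E)
    (hQ : ∀ p ∈ F, Q p ≠ P p ∧ (Q p).IsPrime ∧ Ideal.absNorm (Q p) = p)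
    {s : ℝ} (hs : 0 < s) (hsK : dedekindZeta K s ≠ 0) (N : ℕ) :
    (∏ p ∈ N.primesBelow, (1 + (p : ℝ) ^ (-s))) * ∑ p ∈ F, (p : ℝ) ^ (-s) ≤
      2 ^ E.card * (dedekindZeta K s).re := by
  classical
  set G := N.primesBelow \ E
  have hGE {p : ℕ} (hp : p ∈ G) : p.Prime ∧ p ∉ E :=
    ⟨Nat.prime_of_mem_primesBelow (Finset.mem_sdiff.1 hp).1, (Finset.mem_sdiff.1 hp).2⟩
  have hPn {p : ℕ} (hp : p ∈ G) := (hP p (hGE hp).1 (hGE hp).2)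
  have hdisj : Disjoint (G.image P) (F.image Q) := by
    rw [Finset.disjoint_left]
    intro I hI hI'
    obtain ⟨p, hp, rfl⟩ := Finset.mem_image.1 hI
    obtain ⟨p', hp', h⟩ := Finset.mem_image.1 hI'
    have : p' = p := by rw [← (hQ p' hp').2.2, h, (hPn hp).2]
    subst this
    exact (hQ p' hp').1 h
  have hprime (I) (hI : I ∈ G.image P ∪ F.image Q) : I.IsPrime ∧ I ≠ ⊥ := by
    rw [Ne, ← Ideal.absNorm_eq_zero_iff]
    rcases Finset.mem_union.1 hI with hI | hI
    · obtain ⟨p, hp, rfl⟩ := Finset.mem_image.1 hI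
      exact ⟨(hPn hp).1, by rw [(hPn hp).2]; exact (hGE hp).1.ne_zero⟩
    · obtain ⟨p, hp, rfl⟩ := Finset.mem_image.1 hI
      exact ⟨(hQ p hp).2.1, by rw [(hQ p hp).2.2]; exact (hF p hp).1.ne_zero⟩
  have hmain := prod_one_add_absNorm_rpow_le hprime hsK
  rw [Finset.prod_union hdisj, Finset.prod_image fun p hp p' hp' h ↦ by
      rw [← (hPn hp).2, h, (hPn hp').2], Finset.prod_image fun p hp p' hp' h ↦ by
      rw [← (hQ p hp).2.2, h, (hQ p' hp').2.2],
    Finset.prod_congr rfl fun p hp ↦ by rw [(hPn hp).2],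
    Finset.prod_congr (s₁ := F) rfl fun p hp ↦ by rw [(hQ p hp).2.2]] at hmain
  have hsplit : ∏ p ∈ N.primesBelow, (1 + (p : ℝ) ^ (-s)) ≤
      2 ^ E.card * ∏ p ∈ G, (1 + (p : ℝ) ^ (-s)) := by
    rw [← Finset.prod_inter_mul_prod_sdiff N.primesBelow E]
    gcongr
    refine (Finset.prod_le_prod (g := fun _ ↦ 2) (fun _ _ ↦ by positivity) fun p hp ↦ ?_).trans
      ((Finset.prod_const _).trans_le <|
        pow_le_pow_right₀ one_le_two (Finset.card_le_card Finset.inter_subset_right))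
    have : (p : ℝ) ^ (-s) ≤ 1 := Real.rpow_le_one_of_one_le_of_nonpos
      (mod_cast (Nat.prime_of_mem_primesBelow (Finset.mem_inter.1 hp).1).one_lt.le) (by linarith)
    linarith
  calc _ ≤ (2 ^ E.card * ∏ p ∈ G, (1 + (p : ℝ) ^ (-s))) * ∏ p ∈ F, (1 + (p : ℝ) ^ (-s)) := by
        gcongr
        exact F.sum_le_prod_one_add fun p ↦ by positivity
    _ ≤ _ := by
        rw [mul_assoc]
        gcongr

/-- If almost every prime has a prime ideal of `𝓞 K` of that norm, then those with a second such
ideal have a convergent sum of reciprocals. -/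
theorem NumberField.summable_indicator_prime_inv_of_two_primes {K : Type*} [Field K]
    [NumberField K] {A : Set ℕ}
    (hA : ∀ᶠ p : ℕ in cofinite, p.Prime → ∃ P : Ideal (𝓞 K), P.IsPrime ∧ Ideal.absNorm P = p ∧
      (p ∈ A → ∃ Q : Ideal (𝓞 K), Q ≠ P ∧ Q.IsPrime ∧ Ideal.absNorm Q = p)) :
    Summable ({p : ℕ | p.Prime ∧ p ∈ A}.indicator fun n ↦ (n : ℝ)⁻¹) := by
  classical
  obtain ⟨E, hE⟩ : ∃ E : Finset ℕ, ∀ p ∉ E, p.Prime → ∃ P : Ideal (𝓞 K), P.IsPrime ∧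
      Ideal.absNorm P = p ∧
      (p ∈ A → ∃ Q : Ideal (𝓞 K), Q ≠ P ∧ Q.IsPrime ∧ Ideal.absNorm Q = p) :=
    ⟨(eventually_cofinite.1 hA).toFinset, fun p hp ↦ by simpa using hp⟩
  choose! P hPprime hPnorm Q hQ using hE
  obtain ⟨D, hD⟩ := exists_forall_prod_primesBelow_one_sub_rpow_le
  have hlimK := tendsto_sub_one_mul_dedekindZeta_nhdsGT K
  have hne : ∀ᶠ s : ℝ in 𝓝[>] 1, dedekindZeta K s ≠ 0 := by
    have hres := Complex.ofReal_ne_zero.2 (dedekindZeta_residue_ne_zero K)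
    filter_upwards [hlimK.eventually_ne hres] with s hs
    exact right_ne_zero_of_mul hs
  have hlimK' : Tendsto (fun s : ℝ ↦ (s - 1) * (dedekindZeta K s).re) (𝓝[>] 1)
      (𝓝 (dedekindZeta_residue K)) := by
    refine ((Complex.continuous_re.tendsto _).comp hlimK).congr fun s ↦ ?_
    rw [Function.comp_apply, ← Complex.ofReal_one, ← Complex.ofReal_sub, Complex.re_ofReal_mul]
  have hbound (F : Finset ℕ) (hF : ∀ p ∈ F, (p.Prime ∧ p ∈ A) ∧ p ∉ E) :
      ∑ p ∈ F, (p : ℝ)⁻¹ ≤ D * 2 ^ E.card * dedekindZeta_residue K := by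
    have hlimF : Tendsto (fun s : ℝ ↦ ∑ p ∈ F, (p : ℝ) ^ (-s)) (𝓝[>] 1)
        (𝓝 (∑ p ∈ F, (p : ℝ)⁻¹)) := by
      refine tendsto_finsetSum _ fun p hp ↦ tendsto_nhdsWithin_of_tendsto_nhds ?_
      have hp0 : (p : ℝ) ≠ 0 := mod_cast (hF p hp).1.1.ne_zero
      rw [← Real.rpow_neg_one]
      exact ((Real.continuousAt_const_rpow hp0).tendsto.comp (continuous_neg.tendsto 1))
    have hle : ∀ᶠ s : ℝ in 𝓝[>] 1,
        ((s - 1) * ∑' n : ℕ, 1 / (n : ℝ) ^ s) * ∑ p ∈ F, (p : ℝ) ^ (-s) ≤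
          D * 2 ^ E.card * ((s - 1) * (dedekindZeta K s).re) := by
      filter_upwards [hne, self_mem_nhdsWithin] with s hs (hs1 : 1 < s)
      have hDpos : 0 ≤ D := by simpa using zero_le_one.trans (hD s hs1 0)
      have hzeta : (∑' n : ℕ, 1 / (n : ℝ) ^ s) * ∑ p ∈ F, (p : ℝ) ^ (-s) ≤
          D * (2 ^ E.card * (dedekindZeta K s).re) := by
        refine le_of_tendsto' ((Real.tendsto_prod_primesBelow_one_sub_rpow hs1).mul_const _)
          fun N ↦ ?_
        refine (mul_le_mul_of_nonneg_right (hD s hs1 N)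
          (Finset.sum_nonneg fun _ _ ↦ by positivity)).trans ?_
        rw [mul_assoc]
        refine mul_le_mul_of_nonneg_left (prod_primesBelow_mul_sum_rpow_le
          (fun p hp hpE ↦ ⟨hPprime p hpE hp, hPnorm p hpE hp⟩) (fun p hp ↦ ⟨(hF p hp).1.1,
            (hF p hp).2⟩) (fun p hp ↦ hQ p (hF p hp).2 (hF p hp).1.1 (hF p hp).1.2)
          (by linarith) hs N) hDpos
      have := mul_le_mul_of_nonneg_left hzeta (sub_nonneg.2 hs1.le)
      linarith
    have := le_of_tendsto_of_tendsto (tendsto_sub_mul_tsum_nat_rpow.mul hlimF)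
      (hlimK'.const_mul _) hle
    rwa [one_mul] at this
  rw [← E.summable_compl_iff]
  refine summable_of_sum_le (c := D * 2 ^ E.card * dedekindZeta_residue K)
    (fun p ↦ Set.indicator_nonneg (fun _ _ ↦ by positivity) _) fun u ↦ ?_
  have hmap := Finset.sum_map u (Function.Embedding.subtype _)
    ({p : ℕ | p.Prime ∧ p ∈ A}.indicator fun n ↦ (n : ℝ)⁻¹)
  refine hmap.symm.trans_le ?_
  rw [Finset.sum_indicator_eq_sum_filter]
  refine hbound _ fun p hp ↦ ?_
  obtain ⟨h1, h2⟩ := Finset.mem_filter.1 hp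
  obtain ⟨⟨x, hx⟩, -, rfl⟩ := Finset.mem_map.1 h1
  exact ⟨h2, hx⟩

theorem irreducible_X_pow_sub_C_intCast {q : ℕ} (hq : q.Prime) {a : ℤ}
    (ha : ¬ ∃ b : ℤ, a = b ^ q) : Irreducible (X ^ q - C (a : ℚ)) := by
  refine X_pow_sub_C_irreducible_of_prime hq fun b hb ↦ ha ?_
  have hint : IsIntegral ℤ b := by
    refine IsIntegral.of_pow hq.pos ?_
    rw [hb]
    exact isIntegral_algebraMap (A := ℚ) (x := a)
  obtain ⟨c, rfl⟩ := IsIntegrallyClosed.isIntegral_iff.1 hint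
  exact ⟨c, by rw [eq_intCast] at hb; exact_mod_cast hb.symm⟩

theorem RingOfIntegers.minpoly_eq_of_irreducible_map {K : Type*} [Field K] [NumberField K]
    {θ : 𝓞 K} {f : ℤ[X]} (hf : f.Monic) (hirr : Irreducible (f.map (algebraMap ℤ ℚ)))
    (hθ : aeval (θ : K) f = 0) : minpoly ℤ θ = f := by
  apply map_injective (algebraMap ℤ ℚ) Int.cast_injective
  have hmin := minpoly.isIntegrallyClosed_eq_field_fractions ℚ K (RingOfIntegers.isIntegral θ)
  rw [← hmin]
  exact (minpoly.eq_of_irreducible_of_monic hirr (by rw [aeval_map_algebraMap]; exact hθ)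
    (hf.map _)).symm

theorem exists_numberField_minpoly_eq_X_pow_sub_C {q : ℕ} (hq : q.Prime) {a : ℤ}
    (ha : ¬ ∃ b : ℤ, a = b ^ q) :
    ∃ (K : Type) (_ : Field K) (_ : NumberField K) (θ : 𝓞 K),
      Algebra.adjoin ℚ {(θ : K)} = ⊤ ∧ minpoly ℤ θ = X ^ q - C a := by
  have hirr := irreducible_X_pow_sub_C_intCast hq ha
  have : Fact (Irreducible (X ^ q - C (a : ℚ))) := ⟨hirr⟩
  let K := AdjoinRoot (X ^ q - C (a : ℚ))
  have hmonic := monic_X_pow_sub_C a hq.ne_zero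
  have hmonicQ := monic_X_pow_sub_C (a : ℚ) hq.ne_zero
  have hmap : (X ^ q - C a).map (algebraMap ℤ ℚ) = X ^ q - C (a : ℚ) := by simp
  let r : K := AdjoinRoot.root _
  have hr : aeval r (X ^ q - C a) = 0 := by
    rw [← aeval_map_algebraMap ℚ, hmap]
    exact (AdjoinRoot.aeval_eq _).trans AdjoinRoot.mk_self
  have : FiniteDimensional ℚ K := hmonicQ.finite_adjoinRoot
  have : NumberField K :=
    { to_charZero := charZero_of_injective_algebraMap (algebraMap ℚ K).injective }
  exact ⟨K, inferInstance, inferInstance, ⟨r, X ^ q - C a, hmonic, hr⟩,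
    AdjoinRoot.adjoinRoot_eq_top,
    RingOfIntegers.minpoly_eq_of_irreducible_map hmonic (hmap ▸ hirr) hr⟩

/-- If `p ≡ 1` modulo the prime `q`, then a nonzero `q`-th power modulo `p` has a second
`q`-th root. -/
theorem exists_intCast_pow_eq_and_ne {p q : ℕ} [Fact p.Prime] (hq : q.Prime)
    (hpq : (p : ZMod q) = 1) {x : ℤ} (hx : (x : ZMod p) ≠ 0) :
    ∃ y : ℤ, (y : ZMod p) ^ q = (x : ZMod p) ^ q ∧ (y : ZMod p) ≠ x := by
  have := Fact.mk hq
  have hdvd : q ∣ Nat.card (ZMod p)ˣ := by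
    rw [Nat.card_eq_fintype_card, ZMod.card_units,
      ← ZMod.natCast_eq_zero_iff, Nat.cast_sub (Fact.out : p.Prime).one_le, hpq]
    simp
  obtain ⟨z, hz⟩ := exists_prime_orderOf_dvd_card' q hdvd
  obtain ⟨y, hy⟩ := ZMod.intCast_surjective ((x : ZMod p) * (z : ZMod p))
  refine ⟨y, ?_, fun h ↦ ?_⟩
  · rw [hy, mul_pow, ← Units.val_pow_eq_pow_val, ← hz, pow_orderOf_eq_one, Units.val_one, mul_one]
  · rw [hy, mul_eq_left₀ hx, Units.val_eq_one] at h
    rw [h, orderOf_one] at hz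
    exact hq.one_lt.ne hz

/-- If `a` is not a perfect q-th power (q an odd prime), then there are
infinitely many primes `p` not dividing `a` modulo which `a` is not a q-th
power. -/
theorem stmt10 (q : ℕ) (hq : q.Prime) (hq_odd : Odd q) (a : ℤ)
    (ha : ¬ ∃ b : ℤ, a = b ^ q) :
    {p : ℕ | p.Prime ∧ ¬ ((p : ℤ) ∣ a) ∧
      ¬ ∃ x : ℤ, (p : ℤ) ∣ x ^ q - a}.Infinite := by
  intro hfin
  have := NeZero.mk hq.ne_zero
  have ha0 : a ≠ 0 := by
    rintro rfl
    exact ha ⟨0, (zero_pow hq.ne_zero).symm⟩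
  obtain ⟨K, _, _, θ, hθ, hmin⟩ := exists_numberField_minpoly_eq_X_pow_sub_C hq ha
  have hdvd {n : ℕ} (hn : n ≠ 0) : ∀ᶠ p : ℕ in cofinite, ¬ p ∣ n :=
    eventually_cofinite.2 <| n.divisors.finite_toSet.subset fun p hp ↦ by simpa [hn] using hp
  refine not_summable_indicator_prime_residueClass_inv (isUnit_one (M := ZMod q)) <|
    summable_indicator_prime_inv_of_two_primes (K := K) (A := {p | (p : ZMod q) = 1}) ?_
  filter_upwards [hfin.eventually_cofinite_notMem, hdvd (Int.natAbs_ne_zero.2 ha0),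
    hdvd (RingOfIntegers.exponent_ne_zero_of_adjoin_eq_top hθ)] with p hp hpa hpθ hprime
  have := Fact.mk hprime
  rw [← Int.natCast_dvd] at hpa
  obtain ⟨x, hx⟩ : ∃ x : ℤ, (p : ℤ) ∣ x ^ q - a := by
    by_contra h
    exact hp ⟨hprime, hpa, h⟩
  have hroot {y : ℤ} : (p : ℤ) ∣ (minpoly ℤ θ).eval y ↔ (y : ZMod p) ^ q = a := by
    rw [hmin, ← ZMod.intCast_zmod_eq_zero_iff_dvd]
    simp [sub_eq_zero]
  have hxa : (x : ZMod p) ^ q = a := hroot.1 (by simpa [hmin] using hx)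
  have hx0 : (x : ZMod p) ≠ 0 := by
    intro h
    rw [h, zero_pow hq.ne_zero, eq_comm, ZMod.intCast_zmod_eq_zero_iff_dvd] at hxa
    exact hpa hxa
  obtain ⟨P, hPprime, hPnorm, hPx⟩ :=
    exists_prime_ideal_of_dvd_eval_minpoly hprime hpθ (hroot.2 hxa)
  refine ⟨P, hPprime, hPnorm, fun hpq ↦ ?_⟩
  obtain ⟨y, hy, hyx⟩ := exists_intCast_pow_eq_and_ne hq hpq hx0
  obtain ⟨Q, hQprime, hQnorm, hQy⟩ :=
    exists_prime_ideal_of_dvd_eval_minpoly hprime hpθ (hroot.2 (hy.trans hxa))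
  refine ⟨Q, ?_, hQprime, hQnorm⟩
  rintro rfl
  have hmem : ((y - x : ℤ) : 𝓞 K) ∈ Q := by
    have := Q.sub_mem hPx hQy
    rw [sub_sub_sub_cancel_left] at this
    exact_mod_cast this
  have hpQ : ((p : ℤ) : 𝓞 K) ∈ Q := by
    rw [Int.cast_natCast, ← hQnorm]
    exact Ideal.absNorm_mem Q
  have hcop : IsCoprime (p : ℤ) (y - x) := by
    rw [(Nat.prime_iff_prime_int.1 hprime).coprime_iff_not_dvd, ← ZMod.intCast_zmod_eq_zero_iff_dvd]
    simpa [sub_eq_zero] using hyx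
  obtain ⟨u, v, huv⟩ := hcop
  refine hQprime.ne_top ((Ideal.eq_top_iff_one _).2 ?_)
  have := congrArg (Int.cast : ℤ → 𝓞 K) huv
  rw [Int.cast_one, Int.cast_add, Int.cast_mul, Int.cast_mul] at this
  rw [← this]
  exact Q.add_mem (Q.mul_mem_left _ hpQ) (Q.mul_mem_left _ hmem)
end
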